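/- Assume gcd(s+l,2l) = gcd(s,l) = d and d is even. Let i = p^{s+d−1}(p−1)(p^{s−d} + 1) and λ = p^{s−d−1}·[p^{s+d−1}(p−1)(p^{s−d} + 1) − 1]·(p^{m−2d} − 1)/(p^{2d} − 1). Then the distinct supports of the codewords of Hamming weight i in C form a 2-(p^m, i, λ) design on the point set F_q: each such support has exactly i elements, and every 2-element subset of F_q is contained in exactly λ of the distinct supports. -/

import Mathlib

/-- `trp p r z = z + z^p + ⋯ + z^(p^(r-1))`, the trace form used for `Tr_r`. -/
def trp (p r : ℕ) {F : Type} [Field F] (z : F) : F :=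
  ∑ i ∈ Finset.range r, z ^ p ^ i

/-- The codeword `c(a,b,c,h)` of the code `C`, viewed as a function on `F_q = F`;
its value at `x` is `Tr_s(a x^(p^s+1)) + Tr_m(b x^(p^l+1) + c x) + h` (the values
lie in the prime field `F_p ⊆ F`). Here `m = 2s`. -/
def cword (p s l : ℕ) {F : Type} [Field F] (a b c : F) (h : ZMod p) : F → F :=
  fun x => trp p s (a * x ^ (p ^ s + 1)) + trp p (2 * s) (b * x ^ (p ^ l + 1) + c * x)
    + ZMod.cast h

/-- The support of the codeword `c(a,b,c,h)`; its cardinality is the Hamming weight. -/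
def suppw (p s l : ℕ) {F : Type} [Field F] [Fintype F] [DecidableEq F]
    (a b c : F) (h : ZMod p) : Finset F :=
  Finset.univ.filter fun x => cword p s l a b c h x ≠ 0

section TwistedConjugation

open Finset

set_option linter.unusedSectionVars false
set_option linter.unusedDecidableInType false
set_option linter.unusedFintypeInType false

section TraceCharacter

variable (p : ℕ) [Fact p.Prime] {F : Type} [Field F] [Fintype F] [DecidableEq F]
  [Algebra (ZMod p) F]

/-- The absolute trace of a finite field of characteristic `p`. -/
noncomputable abbrev absTrace (x : F) : ZMod p := Algebra.trace (ZMod p) F x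

/-- The canonical additive character `x ↦ exp (2πi Tr(x) / p)` of a finite field. -/
noncomputable def traceChar (F : Type) [Field F] [Algebra (ZMod p) F] : AddChar F ℂ :=
  (ZMod.stdAddChar (N := p)).compAddMonoidHom (Algebra.trace (ZMod p) F).toAddMonoidHom

theorem traceChar_apply (x : F) : traceChar p F x = ZMod.stdAddChar (absTrace p x) := rfl

theorem exists_absTrace_mul_ne_zero {c : F} (hc : c ≠ 0) : ∃ x : F, absTrace p (c * x) ≠ 0 := by
  obtain ⟨z, hz⟩ := Algebra.trace_surjective (ZMod p) F 1
  exact ⟨c⁻¹ * z, by simp [absTrace, mul_inv_cancel_left₀ hc, hz]⟩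

theorem traceChar_eq_one_iff (x : F) : traceChar p F x = 1 ↔ absTrace p x = 0 := by
  rw [traceChar_apply]
  constructor
  · intro h
    apply ZMod.injective_stdAddChar
    rw [h, AddChar.map_zero_eq_one]
  · intro h
    rw [h, AddChar.map_zero_eq_one]

theorem traceChar_isPrimitive : (traceChar p F).IsPrimitive := by
  intro c hc h
  obtain ⟨x, hx⟩ := exists_absTrace_mul_ne_zero p hc
  apply hx
  rw [← traceChar_eq_one_iff]
  simpa using DFunLike.congr_fun h x

theorem sum_traceChar_mul (c : F) :
    ∑ x, traceChar p F (c * x) = if c = 0 then (Fintype.card F : ℂ) else 0 := by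
  have := AddChar.sum_mulShift c (traceChar_isPrimitive p (F := F))
  simp only [mul_comm c]
  rw [this]
  split_ifs <;> simp

theorem absTrace_ringEquiv (e : F ≃+* F) (x : F) : absTrace p (e x) = absTrace p x :=
  Algebra.trace_eq_of_algEquiv (AlgEquiv.ofRingEquiv (f := e) fun r =>
    RingHom.congr_fun (Subsingleton.elim (e.toRingHom.comp (algebraMap (ZMod p) F))
      (algebraMap (ZMod p) F)) r) x

/-- The size of the fibre of an additive map is a character sum over the kernel of its adjoint. -/
theorem card_fibre_eq_sum_ker_adjoint (f g : F → F)
    (hfg : ∀ x y, traceChar p F (f x * y) = traceChar p F (x * g y)) (w : F) :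
    ((univ.filter fun x => f x = w).card : ℂ)
      = ∑ y ∈ univ.filter (fun y => g y = 0), traceChar p F (-(w * y)) := by
  have hq : (Fintype.card F : ℂ) ≠ 0 := by simp
  apply mul_left_cancel₀ hq
  have h1 : ∑ x, ∑ y, traceChar p F ((f x - w) * y)
      = Fintype.card F * ((univ.filter fun x => f x = w).card : ℂ) := by
    simp only [sum_traceChar_mul, sub_eq_zero]
    rw [← sum_filter, sum_const, nsmul_eq_mul, mul_comm]
  have h2 : ∑ x, ∑ y, traceChar p F ((f x - w) * y)
      = Fintype.card F * ∑ y ∈ univ.filter (fun y => g y = 0), traceChar p F (-(w * y)) := by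
    rw [sum_comm, sum_filter, mul_sum]
    refine sum_congr rfl fun y _ => ?_
    have : ∀ x, traceChar p F ((f x - w) * y)
        = traceChar p F (g y * x) * traceChar p F (-(w * y)) := by
      intro x
      rw [sub_mul, sub_eq_add_neg, AddChar.map_add_eq_mul, hfg, mul_comm x]
    simp only [this]
    rw [← sum_mul, sum_traceChar_mul]
    split_ifs <;> simp
  rw [← h1, h2]

end TraceCharacter

/-- An involution `conj` and a commuting automorphism `twist` of a field of odd characteristic such
that the fixed field of `conj ∘ twist` is contained in the fixed field of `conj`. -/
structure TwistedConj (F : Type) [Field F] where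
  conj : F ≃+* F
  twist : F ≃+* F
  conj_conj : ∀ x, conj (conj x) = x
  conj_twist : ∀ x, conj (twist x) = twist (conj x)
  conj_of_fixed : ∀ x, conj (twist x) = x → conj x = x
  two_ne : (2 : F) ≠ 0

namespace TwistedConj

variable (p : ℕ) [Fact p.Prime] {F : Type} [Field F] [Fintype F] [DecidableEq F]
  [Algebra (ZMod p) F] (D : TwistedConj F)

/-- The linearized operator representing the polar form of `TwistedConj.form`. -/
def lam (a b z : F) : F := a * D.conj z + b * D.twist z + D.twist.symm (b * z)

/-- The quadratic form `x ↦ Tr (a x x̄ / 2 + b x σ(x))`. -/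
noncomputable def form (a b x : F) : ZMod p :=
  absTrace p (a / 2 * (x * D.conj x) + b * (x * D.twist x))

/-- The radical of `TwistedConj.form`. -/
def ker (a b : F) : Finset F := univ.filter fun z => D.lam a b z = 0

/-- The fixed field of `conj ∘ twist`. -/
def fixed : Finset F := univ.filter fun z => D.conj (D.twist z) = z

theorem mem_ker {a b z : F} : z ∈ D.ker a b ↔ D.lam a b z = 0 := by simp [ker]

theorem mem_fixed {z : F} : z ∈ D.fixed ↔ D.conj (D.twist z) = z := by simp [fixed]

theorem lam_add (a b x y : F) : D.lam a b (x + y) = D.lam a b x + D.lam a b y := by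
  simp only [lam, map_add, mul_add]; ring

theorem lam_sub (a b x y : F) : D.lam a b (x - y) = D.lam a b x - D.lam a b y := by
  simp only [lam, map_sub, mul_sub]; ring

theorem lam_zero (a b : F) : D.lam a b 0 = 0 := by simp [lam]

theorem conj_twist_symm (x : F) : D.conj (D.twist.symm x) = D.twist.symm (D.conj x) := by
  apply D.twist.injective
  rw [← D.conj_twist]; simp

theorem absTrace_mul_lam (a b x z : F) (ha : D.conj a = a) :
    absTrace p (x * D.lam a b z) = absTrace p
      (a / 2 * (x * D.conj z + z * D.conj x) + b * (x * D.twist z + z * D.twist x)) := by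
  have h2 := D.two_ne
  have h1 := absTrace_ringEquiv p D.conj (a / 2 * (x * D.conj z))
  have h3 := absTrace_ringEquiv p D.twist (x * D.twist.symm (b * z))
  have hc2 : D.conj 2 = 2 := map_ofNat _ _
  simp only [map_mul, map_div₀, ha, hc2, D.conj_conj, RingEquiv.apply_symm_apply] at h1 h3
  have e1 : x * D.lam a b z = a / 2 * (x * D.conj z) + a / 2 * (x * D.conj z)
      + b * (x * D.twist z) + x * (D.twist.symm b * D.twist.symm z) := by
    simp only [lam, map_mul]; field_simp; ring
  have e2 : a / 2 * (x * D.conj z + z * D.conj x) + b * (x * D.twist z + z * D.twist x)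
     = a / 2 * (x * D.conj z) + a / 2 * (D.conj x * z) + b * (x * D.twist z)
      + D.twist x * (b * z) := by ring
  rw [e1, e2]
  simp only [absTrace, map_add] at *
  rw [h1, h3]

theorem absTrace_lam_mul {a : F} (ha : D.conj a = a) (b x y : F) :
    absTrace p (D.lam a b x * y) = absTrace p (x * D.lam a b y) := by
  rw [mul_comm, D.absTrace_mul_lam p a b y x ha, D.absTrace_mul_lam p a b x y ha]
  congr 1
  ring

theorem form_add {a : F} (ha : D.conj a = a) (b x z : F) :
    D.form p a b (x + z) = D.form p a b x + D.form p a b z + absTrace p (x * D.lam a b z) := by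
  rw [D.absTrace_mul_lam p a b x z ha]
  simp only [form, absTrace, ← map_add]
  congr 1
  simp only [map_add]
  ring

theorem form_of_mem_ker {a b y : F} (ha : D.conj a = a) (hy : D.lam a b y = 0) :
    D.form p a b y = 0 := by
  have h := D.absTrace_mul_lam p a b y y ha
  rw [hy, mul_zero, absTrace, map_zero,
    show a / 2 * (y * D.conj y + y * D.conj y) + b * (y * D.twist y + y * D.twist y)
      = (a / 2 * (y * D.conj y) + b * (y * D.twist y))
       + (a / 2 * (y * D.conj y) + b * (y * D.twist y)) by ring, absTrace, map_add] at h
  change (0 : ZMod p) = D.form p a b y + D.form p a b y at h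
  have h' := congrArg (algebraMap (ZMod p) F) h
  rw [map_zero, map_add, ← two_mul, eq_comm, mul_eq_zero] at h'
  exact (FaithfulSMul.algebraMap_injective (ZMod p) F)
    ((h'.resolve_left D.two_ne).trans (map_zero _).symm)

/-- The Weil sum of the quadratic polynomial `form a b x + Tr (c x)`. -/
noncomputable def expSum (a b c : F) : ℂ :=
  ∑ x, ZMod.stdAddChar (D.form p a b x + absTrace p (c * x))

theorem zero_mem_ker (a b : F) : (0 : F) ∈ D.ker a b := by simp [mem_ker, lam_zero]

theorem norm_expSum_sq_le {a : F} (ha : D.conj a = a) (b c : F) :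
    ‖D.expSum p a b c‖ ^ 2 ≤ Fintype.card F * (D.ker a b).card := by
  have key : D.expSum p a b c * (starRingEnd ℂ) (D.expSum p a b c)
      = ∑ z ∈ D.ker a b, ZMod.stdAddChar (D.form p a b z + absTrace p (c * z))
          * (Fintype.card F : ℂ) := by
    simp only [expSum, map_sum, ← AddChar.map_neg_eq_conj]
    rw [mul_comm, sum_mul_sum]
    have h1 : ∀ x : F, ∑ y, (ZMod.stdAddChar (-(D.form p a b x + absTrace p (c * x))) : ℂ)
        * ZMod.stdAddChar (D.form p a b y + absTrace p (c * y))
        = ∑ z, ZMod.stdAddChar (D.form p a b z + absTrace p (c * z))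
          * traceChar p F (D.lam a b z * x) := by
      intro x
      rw [← Equiv.sum_comp (Equiv.addLeft x)]
      refine sum_congr rfl fun z _ => ?_
      rw [traceChar_apply, ← AddChar.map_add_eq_mul, ← AddChar.map_add_eq_mul,
        Equiv.coe_addLeft, D.form_add p ha, mul_add, mul_comm (D.lam a b z)]
      congr 1
      simp only [absTrace, map_add]
      ring
    simp only [h1]
    rw [sum_comm, ker, sum_filter]
    refine sum_congr rfl fun z _ => ?_
    rw [← mul_sum, sum_traceChar_mul]
    split_ifs <;> simp
  have h2 : ‖D.expSum p a b c‖ ^ 2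
      = ‖D.expSum p a b c * (starRingEnd ℂ) (D.expSum p a b c)‖ := by
    rw [norm_mul, RCLike.norm_conj, sq]
  rw [h2, key]
  refine (norm_sum_le _ _).trans ?_
  simp [AddChar.norm_apply, mul_comm]

theorem expSum_eq_zero {a : F} (ha : D.conj a = a) (b c : F) (hc : ∀ x, D.lam a b x ≠ c) :
    D.expSum p a b c = 0 := by
  obtain ⟨y, hy, hcy⟩ : ∃ y ∈ D.ker a b, traceChar p F (-(c * y)) ≠ 1 := by
    by_contra! hcon
    have h := card_fibre_eq_sum_ker_adjoint p (D.lam a b) (D.lam a b)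
      (fun x y => by rw [traceChar_apply, traceChar_apply, D.absTrace_lam_mul p ha]) c
    rw [filter_false_of_mem fun x _ => hc x] at h
    change _ = ∑ y ∈ D.ker a b, _ at h
    rw [sum_congr rfl hcon, card_empty, sum_const, nsmul_one, eq_comm] at h
    exact (card_pos.2 ⟨0, D.zero_mem_ker a b⟩).ne' (by exact_mod_cast h)
  rw [mem_ker] at hy
  have h : D.expSum p a b c = traceChar p F (c * y) * D.expSum p a b c := by
    conv_lhs => rw [expSum, ← Equiv.sum_comp (Equiv.addRight y)]
    rw [expSum, mul_sum]
    refine sum_congr rfl fun x _ => ?_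
    rw [traceChar_apply, ← AddChar.map_add_eq_mul, Equiv.coe_addRight, D.form_add p ha,
      D.form_of_mem_ker p ha hy, hy, mul_add]
    congr 1
    simp only [absTrace, map_add, mul_zero, map_zero]
    ring
  by_contra hE
  have h1 : traceChar p F (c * y) = 1 := (mul_right_cancel₀ hE (by rw [one_mul]; exact h)).symm
  apply hcy
  rw [AddChar.map_neg_eq_conj, h1, map_one]

theorem lam_scale (a b y z : F) :
    D.lam (a * (y * D.conj y)) (b * (y * D.twist y)) z = y * D.lam a b (y * z) := by
  simp only [lam, map_mul, RingEquiv.symm_apply_apply]; ring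

theorem card_ker_scale (a b : F) {y : F} (hy : y ≠ 0) :
    (D.ker (a * (y * D.conj y)) (b * (y * D.twist y))).card = (D.ker a b).card := by
  refine card_bij (fun z _ => y * z) (fun z hz => ?_) (fun z _ w _ h => mul_left_cancel₀ hy h)
    fun z hz => ⟨y⁻¹ * z, ?_, mul_inv_cancel_left₀ hy z⟩
  · rw [mem_ker, lam_scale, mul_eq_zero] at hz
    exact D.mem_ker.2 (hz.resolve_left hy)
  · rw [mem_ker, lam_scale, mul_inv_cancel_left₀ hy, D.mem_ker.1 hz, mul_zero]

theorem expSum_scale (a b : F) {y : F} (hy : y ≠ 0) :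
    D.expSum p (a * (y * D.conj y)) (b * (y * D.twist y)) 0 = D.expSum p a b 0 := by
  refine Fintype.sum_equiv (Equiv.mulLeft₀ y hy) _ _ fun x => ?_
  simp only [zero_mul, form, Equiv.mulLeft₀_apply, map_mul]
  congr 3
  ring

theorem conj_eq_self_of_one_mem_ker {a b : F} (ha : D.conj a = a) (h : D.lam a b 1 = 0) :
    D.conj b = b := by
  simp only [lam, map_one, mul_one] at h
  have h' := congrArg D.conj h
  simp only [map_add, ha, D.conj_twist_symm, map_zero] at h'
  have h1 : D.twist.symm (b - D.conj b) = -(b - D.conj b) := by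
    rw [map_sub]; linear_combination h - h'
  have h2 : D.twist (b - D.conj b) = -(b - D.conj b) := by
    have := congrArg D.twist h1
    rw [RingEquiv.apply_symm_apply, map_neg] at this
    linear_combination this
  have h3 : D.conj (b - D.conj b) = -(b - D.conj b) := by rw [map_sub, D.conj_conj]; ring
  have h4 := D.conj_of_fixed (b - D.conj b) (by rw [h2, map_neg, h3, neg_neg])
  rw [h3] at h4
  have h5 : 2 * (b - D.conj b) = 0 := by linear_combination -h4
  exact (sub_eq_zero.1 ((mul_eq_zero.1 h5).resolve_left D.two_ne)).symm

theorem eq_of_one_mem_ker {a b : F} (h : D.lam a b 1 = 0) : a = -(b + D.twist.symm b) := by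
  simp only [lam, map_one, mul_one] at h
  linear_combination h

theorem mem_ker_iff_mul_mem_fixed {b : F} (hb : D.conj b = b) (z : F) :
    z ∈ D.ker (-(b + D.twist.symm b)) b ↔ b * (D.conj (D.twist z) - z) ∈ D.fixed := by
  have h : D.lam (-(b + D.twist.symm b)) b z = D.conj (b * (D.conj (D.twist z) - z))
      - D.twist.symm (b * (D.conj (D.twist z) - z)) := by
    simp only [lam, map_mul, map_sub, D.conj_conj, hb, D.conj_twist, RingEquiv.symm_apply_apply]
    ring
  rw [mem_ker, mem_fixed, h, sub_eq_zero, ← D.twist.injective.eq_iff,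
    RingEquiv.apply_symm_apply, ← D.conj_twist]

theorem zero_mem_fixed : (0 : F) ∈ D.fixed := by simp [mem_fixed]

theorem one_mem_fixed : (1 : F) ∈ D.fixed := by simp [mem_fixed]

theorem conj_of_mem_fixed {x : F} (hx : x ∈ D.fixed) : D.conj x = x :=
  D.conj_of_fixed x (D.mem_fixed.1 hx)

theorem card_ker_of_exists {b x₀ : F} (hb : D.conj b = b) (hb0 : b ≠ 0)
    (hx : D.conj (D.twist x₀) - x₀ = b⁻¹) :
    (D.ker (-(b + D.twist.symm b)) b).card = D.fixed.card ^ 2 := by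
  rw [sq, ← card_product]
  symm
  have hx' : D.conj (D.twist x₀) = x₀ + b⁻¹ := by rw [← hx]; ring
  refine card_bij (fun k _ => k.1 + k.2 * x₀) ?_ ?_ ?_
  · rintro ⟨k₁, k₂⟩ hk
    simp only [mem_product, mem_fixed] at hk
    rw [mem_ker_iff_mul_mem_fixed D hb]
    have : b * (D.conj (D.twist (k₁ + k₂ * x₀)) - (k₁ + k₂ * x₀)) = k₂ := by
      rw [map_add, map_add, map_mul, map_mul, hk.1, hk.2, hx']; field_simp; ring
    rw [this, mem_fixed, hk.2]
  · rintro ⟨k₁, k₂⟩ hk ⟨m₁, m₂⟩ hm h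
    simp only [mem_product, mem_fixed] at hk hm
    simp only at h
    have h' := congrArg (fun z => D.conj (D.twist z)) h
    simp only [map_add, map_mul, hk.1, hk.2, hm.1, hm.2, hx'] at h'
    have h2 : (k₂ - m₂) * b⁻¹ = 0 := by linear_combination h' - h
    have h3 : k₂ = m₂ := sub_eq_zero.1 ((mul_eq_zero.1 h2).resolve_right (inv_ne_zero hb0))
    subst h3
    simpa using h
  · intro z hz
    rw [mem_ker_iff_mul_mem_fixed D hb] at hz
    refine ⟨(z - b * (D.conj (D.twist z) - z) * x₀, b * (D.conj (D.twist z) - z)), ?_, by simp⟩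
    rw [mem_product]
    refine ⟨?_, hz⟩
    rw [mem_fixed] at hz ⊢
    simp only
    rw [map_sub, map_sub, map_mul _ (b * _) x₀, map_mul _ (D.twist (b * _)) _, hz, hx']
    field_simp; ring

theorem card_ker_of_not_exists {b : F} (hb : D.conj b = b) (hb0 : b ≠ 0)
    (hx : ¬ ∃ x, D.conj (D.twist x) - x = b⁻¹) :
    (D.ker (-(b + D.twist.symm b)) b).card ≤ D.fixed.card := by
  refine card_le_card fun z hz => ?_
  rw [mem_ker_iff_mul_mem_fixed D hb] at hz
  by_contra hz'
  rw [mem_fixed, ← sub_eq_zero] at hz'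
  set k := b * (D.conj (D.twist z) - z) with hk
  have hk0 : k ≠ 0 := mul_ne_zero hb0 hz'
  rw [mem_fixed] at hz
  refine hx ⟨k⁻¹ * z, ?_⟩
  rw [map_mul, map_mul, map_inv₀, map_inv₀, hz, ← mul_sub, hk, mul_inv]
  field_simp

theorem ker_scale_normal_form {a b : F} (ha : D.conj a = a) (hab : a ≠ 0 ∨ b ≠ 0)
    (hk : (D.ker a b).card ≠ 1) : ∃ y b', y ≠ 0 ∧ b' ≠ 0 ∧ D.conj b' = b' ∧
      b * (y * D.twist y) = b' ∧ a * (y * D.conj y) = -(b' + D.twist.symm b') := by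
  obtain ⟨y, hy, hy0⟩ : ∃ y ∈ D.ker a b, y ≠ 0 := by
    by_contra! hcon
    exact hk (card_eq_one.2 ⟨0, eq_singleton_iff_unique_mem.2 ⟨D.zero_mem_ker a b, hcon⟩⟩)
  have hconj : D.conj (a * (y * D.conj y)) = a * (y * D.conj y) := by
    rw [map_mul, map_mul, ha, D.conj_conj, mul_comm y]
  have h1 : D.lam (a * (y * D.conj y)) (b * (y * D.twist y)) 1 = 0 := by
    rw [lam_scale, mul_one, D.mem_ker.1 hy, mul_zero]
  refine ⟨y, b * (y * D.twist y), hy0, ?_, D.conj_eq_self_of_one_mem_ker hconj h1, rfl,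
    D.eq_of_one_mem_ker h1⟩
  intro hb
  have h2 := D.eq_of_one_mem_ker h1
  rw [hb] at h2
  have hb' : b = 0 := by simpa [hy0] using hb
  have ha' : a = 0 := by simpa [hy0] using h2
  tauto

theorem card_ker_dichotomy {a b : F} (ha : D.conj a = a) (hab : a ≠ 0 ∨ b ≠ 0) :
    (D.ker a b).card = D.fixed.card ^ 2 ∨ (D.ker a b).card ≤ D.fixed.card := by
  by_cases hk : (D.ker a b).card = 1
  · right
    rw [hk]
    exact card_pos.2 ⟨0, D.zero_mem_fixed⟩
  obtain ⟨y, b', hy, hb0, hb, e1, e2⟩ := D.ker_scale_normal_form ha hab hk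
  rw [← D.card_ker_scale a b hy, e1, e2]
  by_cases hx : ∃ x, D.conj (D.twist x) - x = b'⁻¹
  · obtain ⟨x, hx⟩ := hx
    exact Or.inl (D.card_ker_of_exists hb hb0 hx)
  · exact Or.inr (D.card_ker_of_not_exists hb hb0 hx)

theorem one_lt_card_fixed : 1 < D.fixed.card :=
  one_lt_card.2 ⟨0, D.zero_mem_fixed, 1, D.one_mem_fixed, zero_ne_one⟩

theorem sum_traceChar_conj_fixed {v : F} (hv0 : v ≠ 0) (hv : D.conj v = v) :
    ∑ z ∈ univ.filter (fun z => D.conj z = z), traceChar p F (v * z) = 0 := by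
  obtain ⟨x, hx⟩ := exists_absTrace_mul_ne_zero p (mul_ne_zero D.two_ne hv0)
  have hw : traceChar p F (v * (x + D.conj x)) ≠ 1 := by
    rw [Ne, traceChar_eq_one_iff, mul_add, absTrace, map_add]
    have h := absTrace_ringEquiv p D.conj (v * x)
    rw [map_mul, hv, absTrace] at h
    rw [h, ← map_add, ← two_mul, ← mul_assoc]
    exact hx
  set w := x + D.conj x with hwdef
  have hwc : D.conj w = w := by rw [hwdef, map_add, D.conj_conj, add_comm]
  set S := ∑ z ∈ univ.filter (fun z => D.conj z = z), traceChar p F (v * z) with hS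
  have h : S = traceChar p F (v * w) * S := by
    rw [hS, mul_sum]
    refine sum_nbij' (fun z => z - w) (fun z => z + w) ?_ ?_ (by simp) (by simp) ?_
    · simp +contextual [hwc]
    · simp +contextual [hwc]
    · intro z _
      rw [← AddChar.map_add_eq_mul]
      congr 1
      ring
  by_contra hS0
  exact hw (mul_right_cancel₀ hS0 (by rw [one_mul]; exact h)).symm

theorem sum_traceChar_norm {Q : ℕ}
    (hnorm : ∀ z, z ≠ 0 → D.conj z = z → (univ.filter fun y => y * D.conj y = z).card = Q + 1)
    {v : F} (hv0 : v ≠ 0) (hv : D.conj v = v) :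
    ∑ y, traceChar p F (v * (y * D.conj y)) = -Q := by
  have hmaps : ∀ y ∈ (univ : Finset F), y * D.conj y ∈ univ.filter (fun z => D.conj z = z) := by
    intro y _
    simp [D.conj_conj, mul_comm]
  rw [← sum_fiberwise_of_maps_to hmaps]
  have h1 : ∀ z ∈ univ.filter (fun z => D.conj z = z),
      ∑ y ∈ univ.filter (fun y => y * D.conj y = z), traceChar p F (v * (y * D.conj y))
        = (Q + 1) * traceChar p F (v * z) - if z = 0 then (Q : ℂ) else 0 := by
    intro z hz
    rw [sum_congr rfl fun y hy => by rw [(mem_filter.1 hy).2], sum_const, nsmul_eq_mul]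
    split_ifs with hz0
    · subst hz0
      have : (univ.filter fun y => y * D.conj y = 0) = {0} := by ext y; simp
      rw [this]
      simp
    · rw [hnorm z hz0 (mem_filter.1 hz).2]
      push_cast
      ring
  rw [sum_congr rfl h1, sum_sub_distrib, ← mul_sum, D.sum_traceChar_conj_fixed p hv0 hv,
    sum_ite_eq']
  simp

theorem form_normal_form {b : F} (hb : D.conj b = b) (x : F) :
    D.form p (-(b + D.twist.symm b)) b x = absTrace p
      (-b / 2 * ((D.conj (D.twist x) - x) * D.conj (D.conj (D.twist x) - x))) := by
  have h1 := absTrace_ringEquiv p D.twist.symm (b / 2 * (D.conj (D.twist x) * D.twist x))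
  have h2 := absTrace_ringEquiv p D.conj (b / 2 * (D.conj (D.twist x) * D.conj x))
  have hc2 : D.conj 2 = 2 := map_ofNat _ _
  have hc3 : D.twist.symm 2 = 2 := map_ofNat _ _
  simp only [map_mul, map_div₀, hb, hc2, hc3, D.conj_conj, D.conj_twist,
    RingEquiv.symm_apply_apply] at h1 h2
  have h20 := D.two_ne
  rw [form, show -(b + D.twist.symm b) / 2 * (x * D.conj x) + b * (x * D.twist x)
    = b / 2 * (D.twist x * x) + b / 2 * (D.twist x * x) - b / 2 * (x * D.conj x)
      - D.twist.symm b / 2 * (D.conj x * x) by field_simp; ring]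
  rw [map_sub, D.conj_conj, show -b / 2 * ((D.conj (D.twist x) - x) * (D.twist x - D.conj x))
    = b / 2 * (D.twist x * x) + b / 2 * (D.twist (D.conj x) * D.conj x) - b / 2 * (x * D.conj x)
      - b / 2 * (D.twist (D.conj x) * D.twist x) by rw [D.conj_twist]; field_simp; ring]
  simp only [absTrace, map_add, map_sub] at *
  rw [h1, h2]

theorem expSum_normal_form {Q : ℕ}
    (hnorm : ∀ z, z ≠ 0 → D.conj z = z → (univ.filter fun y => y * D.conj y = z).card = Q + 1)
    {b x₀ : F} (hb : D.conj b = b) (hb0 : b ≠ 0) (hx : D.conj (D.twist x₀) - x₀ = b⁻¹) :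
    D.expSum p (-(b + D.twist.symm b)) b 0 = -(Q * D.fixed.card) := by
  have h20 := D.two_ne
  have hc2 : D.conj 2 = 2 := map_ofNat _ _
  set v := -b / 2 with hvdef
  have hv0 : v ≠ 0 := div_ne_zero (neg_ne_zero.2 hb0) h20
  have hv : D.conj v = v := by rw [hvdef, map_div₀, map_neg, hb, hc2]
  have hadj : ∀ x y, traceChar p F ((D.conj (D.twist x) - x) * y)
      = traceChar p F (x * (D.conj (D.twist.symm y) - y)) := by
    intro x y
    have h1 := absTrace_ringEquiv p D.twist (x * D.conj (D.twist.symm y))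
    have h2 := absTrace_ringEquiv p D.conj (D.twist x * D.conj y)
    rw [map_mul, ← D.conj_twist, RingEquiv.apply_symm_apply] at h1
    rw [map_mul, D.conj_conj, h1] at h2
    rw [traceChar_apply, traceChar_apply, sub_mul, mul_sub]
    simp only [absTrace, map_sub] at *
    rw [h2]
  have hker : (univ.filter fun y => D.conj (D.twist.symm y) - y = 0) = D.fixed := by
    ext y
    rw [mem_filter, mem_fixed, sub_eq_zero, D.conj_twist_symm, ← D.twist.injective.eq_iff,
      RingEquiv.apply_symm_apply, ← D.conj.injective.eq_iff, D.conj_conj, eq_comm (a := y)]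
    simp
  have hfib := card_fibre_eq_sum_ker_adjoint p _ _ hadj
  rw [hker] at hfib
  have h1 : D.expSum p (-(b + D.twist.symm b)) b 0
      = ∑ y, ∑ k ∈ D.fixed, traceChar p F (-(y * k)) * traceChar p F (v * (y * D.conj y)) := by
    rw [expSum, ← sum_fiberwise univ (fun x => D.conj (D.twist x) - x)]
    refine sum_congr rfl fun y _ => ?_
    rw [← sum_mul, ← hfib, ← nsmul_eq_mul, ← sum_const]
    refine sum_congr rfl fun x hx => ?_
    rw [zero_mul, D.form_normal_form p hb, (mem_filter.1 hx).2, traceChar_apply, absTrace, absTrace,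
      map_zero, add_zero]
  have h2 : ∀ k ∈ D.fixed,
      ∑ y, traceChar p F (-(y * k)) * traceChar p F (v * (y * D.conj y)) = -Q := by
    intro k hk
    have hkc := D.conj_of_mem_fixed hk
    rw [mem_fixed] at hk
    rw [← D.sum_traceChar_norm p hnorm hv0 hv]
    refine Fintype.sum_equiv (Equiv.addRight (k / b)) _ _ fun y => ?_
    rw [← AddChar.map_add_eq_mul, Equiv.coe_addRight, traceChar_apply, traceChar_apply]
    have e1 := absTrace_ringEquiv p D.conj (k / 2 * y)
    have e2 := absTrace_ringEquiv p D.twist (k ^ 2 / 2 * x₀)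
    have e3 := absTrace_ringEquiv p D.conj (D.twist (k ^ 2 / 2 * x₀))
    have ht2 : D.twist 2 = 2 := map_ofNat _ _
    simp only [map_mul, map_div₀, hkc, hc2, map_pow, ht2, hk] at e1 e2 e3
    have e4 : v * ((y + k / b) * D.conj (y + k / b)) = -(y * k) + v * (y * D.conj y)
        + k / 2 * y - k / 2 * D.conj y - (k ^ 2 / 2 * D.conj (D.twist x₀) - k ^ 2 / 2 * x₀) := by
      rw [← mul_sub, hx, map_add, map_div₀, hkc, hb, hvdef]
      field_simp
      ring
    rw [e4]
    congr 1
    simp only [absTrace, map_add, map_sub] at *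
    rw [e1, e3, e2]
    ring
  rw [h1, sum_comm, sum_congr rfl h2, sum_const, nsmul_eq_mul]
  ring

theorem expSum_of_card_ker {Q : ℕ}
    (hnorm : ∀ z, z ≠ 0 → D.conj z = z → (univ.filter fun y => y * D.conj y = z).card = Q + 1)
    {a b : F} (ha : D.conj a = a) (hab : a ≠ 0 ∨ b ≠ 0)
    (hk : (D.ker a b).card = D.fixed.card ^ 2) :
    D.expSum p a b 0 = -(Q * D.fixed.card) := by
  have hP := D.one_lt_card_fixed
  obtain ⟨y, b', hy, hb0, hb, e1, e2⟩ := D.ker_scale_normal_form ha hab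
    (by rw [hk]; exact (Nat.one_lt_pow (by norm_num) hP).ne')
  rw [← D.expSum_scale p a b hy]
  rw [← D.card_ker_scale a b hy] at hk
  rw [e1, e2] at hk ⊢
  by_cases hx : ∃ x, D.conj (D.twist x) - x = b'⁻¹
  · obtain ⟨x, hx⟩ := hx
    exact D.expSum_normal_form p hnorm hb hb0 hx
  · have := D.card_ker_of_not_exists hb hb0 hx
    rw [hk] at this
    nlinarith

/-- The nonzero parameter pairs whose quadratic form has a radical of the maximal size. -/
def degenerate : Finset (F × F) := univ.filter fun t =>
  D.conj t.1 = t.1 ∧ (D.ker t.1 t.2).card = D.fixed.card ^ 2 ∧ (t.1 ≠ 0 ∨ t.2 ≠ 0)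

/-- The parameters `b` such that `1` lies in a radical of the maximal size. -/
def degenerateAtOne : Finset F := univ.filter fun b =>
  D.conj b = b ∧ b ≠ 0 ∧ ∃ x, D.conj (D.twist x) - x = b⁻¹

theorem card_degenerateAtOne :
    (D.degenerateAtOne.card + 1) * D.fixed.card = (univ.filter fun z => D.conj z = z).card := by
  set f : F → F := fun x => D.conj (D.twist x) - x with hf
  have hfix : ∀ x y, f x = f y ↔ x - y ∈ D.fixed := by
    intro x y
    rw [mem_fixed, map_sub, map_sub, hf]
    constructor <;> intro h <;> linear_combination h
  set s := univ.filter (fun z => D.conj z = z) with hs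
  have h1 : s.card = (s.image f).card * D.fixed.card := by
    rw [card_eq_sum_card_image f s, ← smul_eq_mul]
    refine sum_eq_card_nsmul ?_
    intro z hz
    obtain ⟨x₀, hx₀, rfl⟩ := mem_image.1 hz
    refine card_nbij' (fun x => x - x₀) (fun k => k + x₀) ?_ ?_ (fun x _ => sub_add_cancel x x₀)
      fun k _ => add_sub_cancel_right k x₀
    · intro x hx
      exact (hfix x x₀).1 (mem_filter.1 hx).2
    · intro k hk
      simp only [coe_filter, Set.mem_ofPred_eq, hs, mem_filter, mem_univ, true_and] at *
      refine ⟨by rw [map_add, hx₀, D.conj_of_mem_fixed hk], (hfix _ _).2 ?_⟩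
      simpa using hk
  have h2 : s.image f = insert 0 (D.degenerateAtOne.image fun b => b⁻¹) := by
    ext z
    simp only [mem_image, mem_insert, hs, mem_filter, mem_univ, true_and, degenerateAtOne]
    constructor
    · rintro ⟨x, hx, rfl⟩
      by_cases h0 : f x = 0
      · exact Or.inl h0
      · refine Or.inr ⟨(f x)⁻¹, ⟨?_, inv_ne_zero h0, x, by rw [inv_inv]⟩, inv_inv _⟩
        simp only [hf, map_inv₀, map_sub, D.conj_twist, hx]
    · rintro (rfl | ⟨b, ⟨hb, hb0, x, hx⟩, rfl⟩)
      · exact ⟨0, by simp, by simp [hf]⟩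
      · have hc2 : D.conj 2 = 2 := map_ofNat _ _
        have ht2 : D.twist 2 = 2 := map_ofNat _ _
        have h20 := D.two_ne
        refine ⟨(x + D.conj x) / 2, ?_, ?_⟩
        · rw [map_div₀, map_add, D.conj_conj, hc2, add_comm]
        · have hx' := congrArg D.conj hx
          rw [map_inv₀, hb, map_sub, D.conj_conj] at hx'
          have : b⁻¹ = (b⁻¹ + b⁻¹) / 2 := by field_simp; ring
          rw [this]
          nth_rewrite 1 [← hx]
          rw [← hx', hf]
          simp only [map_div₀, map_add, D.conj_twist, D.conj_conj, hc2, ht2]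
          field_simp
          ring
  rw [h1, h2, card_insert_of_notMem, card_image_of_injective _ inv_injective]
  simp [degenerateAtOne]

theorem card_degenerate :
    D.degenerate.card * (D.fixed.card ^ 2 - 1) = (Fintype.card F - 1) * D.degenerateAtOne.card := by
  have ht : (univ.erase (0 : F)).card = Fintype.card F - 1 := by
    rw [card_erase_of_mem (mem_univ _), card_univ]
  rw [← ht]
  refine card_mul_eq_card_mul (fun t y => y ∈ D.ker t.1 t.2) ?_ ?_
  · intro t htm
    have : bipartiteAbove (fun (t : F × F) y => y ∈ D.ker t.1 t.2) (univ.erase 0) t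
        = (D.ker t.1 t.2).erase 0 := by
      ext y; simp [bipartiteAbove]
    rw [this, card_erase_of_mem (D.zero_mem_ker _ _), (mem_filter.1 htm).2.2.1]
  · intro y hy
    have hy0 : y ≠ 0 := (mem_erase.1 hy).1
    have hN : y * D.conj y ≠ 0 := mul_ne_zero hy0 (by simpa using hy0)
    have hT : y * D.twist y ≠ 0 := mul_ne_zero hy0 (by simpa using hy0)
    have hNc : D.conj (y * D.conj y) = y * D.conj y := by rw [map_mul, D.conj_conj, mul_comm]
    refine card_nbij' (fun t => t.2 * (y * D.twist y))
      (fun b => (-(b + D.twist.symm b) * (y * D.conj y)⁻¹, b * (y * D.twist y)⁻¹)) ?_ ?_ ?_ ?_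
    · rintro ⟨a, b⟩ hab
      simp only [bipartiteBelow, degenerate, degenerateAtOne, coe_filter, mem_filter, mem_univ,
        true_and, Set.mem_ofPred_eq] at *
      obtain ⟨⟨ha, hk, hab⟩, hyk⟩ := hab
      have h1 : D.lam (a * (y * D.conj y)) (b * (y * D.twist y)) 1 = 0 := by
        rw [lam_scale, mul_one, D.mem_ker.1 hyk, mul_zero]
      have hac : D.conj (a * (y * D.conj y)) = a * (y * D.conj y) := by rw [map_mul, ha, hNc]
      have hbc := D.conj_eq_self_of_one_mem_ker hac h1
      have hae := D.eq_of_one_mem_ker h1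
      have hb0 : b * (y * D.twist y) ≠ 0 := by
        intro hb
        rw [hb] at hae
        have hb' : b = 0 := (mul_eq_zero.1 hb).resolve_right hT
        have ha' : a = 0 := (mul_eq_zero.1 (by simpa using hae)).resolve_right hN
        tauto
      refine ⟨hbc, hb0, ?_⟩
      by_contra hx
      have h2 := D.card_ker_of_not_exists hbc hb0 hx
      rw [← hae, D.card_ker_scale _ _ hy0, hk] at h2
      have := D.one_lt_card_fixed
      nlinarith
    · intro b hb
      simp only [bipartiteBelow, degenerate, degenerateAtOne, coe_filter, mem_filter, mem_univ,
        true_and, Set.mem_ofPred_eq] at *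
      obtain ⟨hb, hb0, x, hx⟩ := hb
      refine ⟨⟨?_, ?_, Or.inr (mul_ne_zero hb0 (inv_ne_zero hT))⟩, ?_⟩
      · rw [map_mul, map_inv₀, hNc, map_neg, map_add, D.conj_twist_symm, hb]
      · rw [← D.card_ker_scale _ _ hy0, inv_mul_cancel_right₀ hN, inv_mul_cancel_right₀ hT]
        exact D.card_ker_of_exists hb hb0 hx
      · have h1 := D.lam_scale (-(b + D.twist.symm b) * (y * D.conj y)⁻¹)
          (b * (y * D.twist y)⁻¹) y 1
        rw [inv_mul_cancel_right₀ hN, inv_mul_cancel_right₀ hT, mul_one, eq_comm,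
          show D.lam (-(b + D.twist.symm b)) b 1 = 0 by simp [lam]] at h1
        exact D.mem_ker.2 ((mul_eq_zero.1 h1).resolve_left hy0)
    · rintro ⟨a, b⟩ hab
      simp only [bipartiteBelow, coe_filter, Set.mem_ofPred_eq] at hab
      have h1 : D.lam (a * (y * D.conj y)) (b * (y * D.twist y)) 1 = 0 := by
        rw [lam_scale, mul_one, D.mem_ker.1 hab.2, mul_zero]
      simp only
      rw [← D.eq_of_one_mem_ker h1, mul_inv_cancel_right₀ hN, mul_inv_cancel_right₀ hT]
    · intro b _
      exact inv_mul_cancel_right₀ hT b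

/-- The word `x ↦ form a b x + Tr (c x) + h` with parameters `t = (a, b, c, h)`. -/
noncomputable def word (t : F × F × F × ZMod p) (x : F) : ZMod p :=
  D.form p t.1 t.2.1 x + absTrace p (t.2.2.1 * x) + t.2.2.2

/-- The support of `TwistedConj.word`. -/
noncomputable def supp (t : F × F × F × ZMod p) : Finset F := univ.filter fun x => D.word p t x ≠ 0

/-- The sum of the standard additive character over the values of a word. -/
noncomputable def wordSum (t : F × F × F × ZMod p) : ℂ := ∑ x, ZMod.stdAddChar (D.word p t x)

theorem lam_smul (u : ZMod p) (a b z : F) : D.lam (u • a) (u • b) z = u • D.lam a b z := by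
  simp only [lam, smul_mul_assoc, ZMod.map_smul, smul_add]

theorem form_smul (u : ZMod p) (a b x : F) :
    D.form p (u • a) (u • b) x = u * D.form p a b x := by
  have : u • a / 2 * (x * D.conj x) + u • b * (x * D.twist x)
      = u • (a / 2 * (x * D.conj x) + b * (x * D.twist x)) := by
    rw [smul_add, ← smul_mul_assoc, ← smul_mul_assoc, smul_div_assoc]
  rw [form, this, absTrace, map_smul, smul_eq_mul, form]

theorem word_smul (u : ZMod p) (t : F × F × F × ZMod p) (x : F) :
    D.word p (u • t) x = u * D.word p t x := by
  have : absTrace p (u • t.2.2.1 * x) = u * absTrace p (t.2.2.1 * x) := by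
    rw [smul_mul_assoc, absTrace, map_smul, smul_eq_mul]
  simp only [word, Prod.smul_fst, Prod.smul_snd, form_smul, this, smul_eq_mul]
  ring

theorem ker_smul {u : ZMod p} (hu : u ≠ 0) (a b : F) : D.ker (u • a) (u • b) = D.ker a b := by
  ext z
  rw [mem_ker, mem_ker, lam_smul, smul_eq_zero]
  simp [hu]

theorem wordSum_eq (t : F × F × F × ZMod p) :
    D.wordSum p t = ZMod.stdAddChar t.2.2.2 * D.expSum p t.1 t.2.1 t.2.2.1 := by
  rw [wordSum, expSum, mul_sum]
  refine sum_congr rfl fun x _ => ?_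
  rw [word, AddChar.map_add_eq_mul, mul_comm]

theorem norm_wordSum (t : F × F × F × ZMod p) :
    ‖D.wordSum p t‖ = ‖D.expSum p t.1 t.2.1 t.2.2.1‖ := by
  rw [wordSum_eq, norm_mul, AddChar.norm_apply, one_mul]

theorem card_supp_eq (t : F × F × F × ZMod p) :
    (p : ℂ) * (D.supp p t).card = (p - 1) * Fintype.card F
      - ∑ u ∈ univ.erase (0 : ZMod p), D.wordSum p (u • t) := by
  have h1 : ∑ u : ZMod p, D.wordSum p (u • t)
      = p * ((univ.filter fun x => D.word p t x = 0).card : ℂ) := by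
    simp only [wordSum, word_smul]
    rw [sum_comm]
    simp only [AddChar.sum_mulShift _ (ZMod.isPrimitive_stdAddChar p), ZMod.card]
    simp only [Nat.cast_ite, Nat.cast_zero]
    rw [← sum_filter, sum_const, nsmul_eq_mul, mul_comm]
  have h2 : D.wordSum p ((0 : ZMod p) • t) = Fintype.card F := by
    simp only [wordSum, word_smul, zero_mul, AddChar.map_zero_eq_one]
    simp
  have h3 : ((univ.filter fun x => D.word p t x = 0).card : ℂ) + (D.supp p t).card
      = Fintype.card F := by
    rw [supp]
    exact_mod_cast card_filter_add_card_filter_not (s := (univ : Finset F)) _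
  rw [← add_sum_erase _ _ (mem_univ (0 : ZMod p)), h2] at h1
  linear_combination h1 + p * h3

theorem card_erase_zero : ((univ.erase (0 : ZMod p)).card : ℝ) = p - 1 := by
  rw [card_erase_of_mem (mem_univ _), card_univ, ZMod.card, Nat.cast_sub NeZero.one_le,
    Nat.cast_one]

theorem sum_erase_zero_stdAddChar (k : ZMod p) :
    ∑ u ∈ univ.erase (0 : ZMod p), (ZMod.stdAddChar (u * k) : ℂ)
      = if k = 0 then (p - 1 : ℂ) else -1 := by
  have h := AddChar.sum_mulShift k (ZMod.isPrimitive_stdAddChar p)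
  rw [← add_sum_erase _ _ (mem_univ (0 : ZMod p)), zero_mul, AddChar.map_zero_eq_one,
    ZMod.card] at h
  rw [eq_sub_of_add_eq' h]
  split_ifs <;> simp

section Weights

variable {Q : ℕ} (hq : Fintype.card F = Q ^ 2)

include hq in
theorem norm_wordSum_smul_le {t : F × F × F × ZMod p} (ha : D.conj t.1 = t.1)
    (hab : t.1 ≠ 0 ∨ t.2.1 ≠ 0) {u : ZMod p} (hu : u ≠ 0) :
    ‖D.wordSum p (u • t)‖ ≤ Q * D.fixed.card := by
  rw [norm_wordSum]
  have h := D.norm_expSum_sq_le p (a := u • t.1) (by rw [ZMod.map_smul, ha]) (u • t.2.1)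
    (u • t.2.2.1)
  rw [ker_smul p D hu, hq] at h
  have h2 : ((D.ker t.1 t.2.1).card : ℝ) ≤ D.fixed.card ^ 2 := by
    have h3 := D.one_lt_card_fixed
    rcases D.card_ker_dichotomy ha hab with h4 | h4
    · rw [h4]; push_cast; rfl
    · exact_mod_cast h4.trans (Nat.le_self_pow two_ne_zero _)
  refine le_of_sq_le_sq (h.trans ?_) (by positivity)
  rw [mul_pow]
  push_cast
  gcongr

include hq in
theorem le_card_supp {t : F × F × F × ZMod p} (ha : D.conj t.1 = t.1)
    (hab : t.1 ≠ 0 ∨ t.2.1 ≠ 0) :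
    ((p : ℝ) - 1) * (Q ^ 2 - Q * D.fixed.card) ≤ p * (D.supp p t).card := by
  have h := D.card_supp_eq p t
  have h1 : ‖∑ u ∈ univ.erase (0 : ZMod p), D.wordSum p (u • t)‖
      ≤ ((p : ℝ) - 1) * (Q * D.fixed.card) := by
    rw [← card_erase_zero p, ← nsmul_eq_mul]
    exact (norm_sum_le _ _).trans (sum_le_card_nsmul _ _ _ fun u hu =>
      D.norm_wordSum_smul_le p hq ha hab (mem_erase.1 hu).1)
  have h2 : ∑ u ∈ univ.erase (0 : ZMod p), D.wordSum p (u • t)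
      = (((p - 1) * Q ^ 2 - p * (D.supp p t).card : ℝ) : ℂ) := by
    rw [hq] at h
    push_cast at h ⊢
    linear_combination h
  rw [h2, Complex.norm_real] at h1
  have h3 := (le_abs_self _).trans h1
  linarith

end Weights

theorem word_of_lam {a : F} (ha : D.conj a = a) (b x₀ : F) (h : ZMod p) (x : F) :
    D.word p (a, b, D.lam a b x₀, h) x = D.form p a b (x + x₀) + (h - D.form p a b x₀) := by
  rw [word, D.form_add p ha, mul_comm x]
  ring

theorem mem_degenerate {t : F × F} : t ∈ D.degenerate ↔
    D.conj t.1 = t.1 ∧ (D.ker t.1 t.2).card = D.fixed.card ^ 2 ∧ (t.1 ≠ 0 ∨ t.2 ≠ 0) := by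
  simp [degenerate]

theorem card_supp_of_linear {c : F} (hc : c ≠ 0) (h : ZMod p) :
    (p : ℂ) * (D.supp p (0, 0, c, h)).card = (p - 1) * Fintype.card F := by
  rw [card_supp_eq, sum_eq_zero, sub_zero]
  intro u hu
  rw [wordSum_eq, expSum]
  simp only [Prod.smul_mk, smul_zero, form, zero_mul, zero_div, add_zero, absTrace, map_zero,
    zero_add]
  have := sum_traceChar_mul p (u • c)
  rw [if_neg (smul_ne_zero (mem_erase.1 hu).1 hc)] at this
  simp only [traceChar_apply, absTrace] at this
  rw [this, mul_zero]

theorem card_supp_of_const {h : ZMod p} (hh : h ≠ 0) :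
    (D.supp p (0, 0, 0, h)).card = Fintype.card F := by
  rw [supp, filter_true_of_mem, card_univ]
  intro x _
  simpa [word, form] using hh

section Extremal

variable {Q : ℕ} (hq : Fintype.card F = Q ^ 2) (hQ : 2 * p * D.fixed.card ≤ Q)
  (hnorm : ∀ z, z ≠ 0 → D.conj z = z → (univ.filter fun y => y * D.conj y = z).card = Q + 1)

include hnorm in
theorem sum_wordSum_of_degenerate {a b : F} (hab : (a, b) ∈ D.degenerate) (x₀ : F) (h : ZMod p) :
    ∑ u ∈ univ.erase (0 : ZMod p), D.wordSum p (u • (a, b, D.lam a b x₀, h))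
      = -(Q * D.fixed.card) * if h = D.form p a b x₀ then (p - 1 : ℂ) else -1 := by
  obtain ⟨ha, hk, hab0⟩ := D.mem_degenerate.1 hab
  simp only at ha hk hab0
  simp only [← sub_eq_zero (a := h)]
  rw [← sum_erase_zero_stdAddChar, mul_sum]
  refine sum_congr rfl fun u hu => ?_
  have hu := (mem_erase.1 hu).1
  rw [← D.expSum_of_card_ker p hnorm (a := u • a) (b := u • b) (by rw [ZMod.map_smul, ha])
    (by simpa [hu] using hab0) (by rw [ker_smul p D hu, hk]), wordSum, expSum, sum_mul]
  refine Fintype.sum_equiv (Equiv.addRight x₀) _ _ fun x => ?_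
  rw [word_smul, D.word_of_lam p ha, form_smul, Equiv.coe_addRight, zero_mul, absTrace, map_zero,
    add_zero, mul_add, AddChar.map_add_eq_mul]

include hq hnorm hQ in
theorem card_supp_eq_iff {t : F × F × F × ZMod p} (ha : D.conj t.1 = t.1) :
    (p : ℝ) * (D.supp p t).card = (p - 1) * (Q ^ 2 + Q * D.fixed.card) ↔
      (t.1, t.2.1) ∈ D.degenerate ∧
        ∃ x₀, t.2.2.1 = D.lam t.1 t.2.1 x₀ ∧ t.2.2.2 = D.form p t.1 t.2.1 x₀ := by
  obtain ⟨a, b, c, h⟩ := t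
  simp only at ha ⊢
  have hP := D.one_lt_card_fixed
  have hp : 1 < p := (Fact.out : p.Prime).one_lt
  have hpR : (1 : ℝ) < p := by exact_mod_cast hp
  have hPR : (1 : ℝ) < D.fixed.card := by exact_mod_cast hP
  have hQR : 2 * (p : ℝ) * D.fixed.card ≤ Q := by exact_mod_cast hQ
  have hQ0 : (0 : ℝ) < Q := lt_of_lt_of_le (by positivity) hQR
  have hPC : (D.fixed.card : ℂ) ≠ 0 := by exact_mod_cast (by omega : D.fixed.card ≠ 0)
  have hQC : (Q : ℂ) ≠ 0 := by exact_mod_cast hQ0.ne'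
  have hpC : (p : ℂ) ≠ 0 := by exact_mod_cast (by omega : p ≠ 0)
  have hpC1 : (p : ℂ) - 1 ≠ 0 := by
    rw [sub_ne_zero]; exact_mod_cast (by omega : p ≠ 1)
  have hequiv : (p : ℝ) * (D.supp p (a, b, c, h)).card = (p - 1) * (Q ^ 2 + Q * D.fixed.card) ↔
      ∑ u ∈ univ.erase (0 : ZMod p), D.wordSum p (u • (a, b, c, h))
        = -(Q * D.fixed.card) * (p - 1 : ℂ) := by
    have h1 := D.card_supp_eq p (a, b, c, h)
    rw [hq] at h1
    rw [← Complex.ofReal_inj]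
    push_cast at h1 ⊢
    rw [h1]
    constructor <;> intro h2 <;> linear_combination -h2
  constructor
  · intro hw
    have hab0 : a ≠ 0 ∨ b ≠ 0 := by
      by_contra! hcon
      obtain ⟨rfl, rfl⟩ := hcon
      have hpos : (0 : ℝ) < (p - 1) * (Q * D.fixed.card) := by
        have : (0 : ℝ) < p - 1 := by linarith
        positivity
      by_cases hc : c = 0
      · subst hc
        by_cases hh : h = 0
        · have h0 : D.supp p (0, 0, 0, h) = ∅ := by
            subst hh
            rw [supp, filter_false_of_mem]
            intro x _
            simp [word, form]
          rw [h0, card_empty, Nat.cast_zero, mul_zero] at hw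
          have := mul_nonneg (by linarith : (0 : ℝ) ≤ p - 1) (sq_nonneg (Q : ℝ))
          linarith
        · rw [D.card_supp_of_const p hh, hq] at hw
          push_cast at hw
          have : (Q : ℝ) * Q = Q * ((p - 1) * D.fixed.card) := by linear_combination hw
          have := mul_left_cancel₀ hQ0.ne' this
          nlinarith
      · have h1 := D.card_supp_of_linear p hc h
        rw [hq] at h1
        have h2 : (p : ℝ) * (D.supp p (0, 0, c, h)).card = (p - 1) * Q ^ 2 := by
          exact_mod_cast h1
        rw [h2] at hw
        linarith
    have hdeg : (a, b) ∈ D.degenerate := by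
      refine D.mem_degenerate.2 ⟨ha, ?_, hab0⟩
      refine (D.card_ker_dichotomy ha hab0).resolve_right fun hk => ?_
      have hlt : ∀ u ∈ univ.erase (0 : ZMod p),
          ‖D.wordSum p (u • (a, b, c, h))‖ < Q * D.fixed.card := by
        intro u hu
        rw [norm_wordSum]
        have h1 := D.norm_expSum_sq_le p (a := u • a) (by rw [ZMod.map_smul, ha]) (u • b) (u • c)
        rw [ker_smul p D (mem_erase.1 hu).1, hq] at h1
        refine lt_of_pow_lt_pow_left₀ 2 (by positivity) (h1.trans_lt ?_)
        rw [mul_pow]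
        push_cast
        have h2 : ((D.ker a b).card : ℝ) ≤ D.fixed.card := by exact_mod_cast hk
        have h3 : (D.fixed.card : ℝ) < D.fixed.card ^ 2 := by nlinarith
        exact mul_lt_mul_of_pos_left (h2.trans_lt h3) (by positivity)
      have hne : (univ.erase (0 : ZMod p)).Nonempty := ⟨1, by simp⟩
      have h1 := (norm_sum_le _ _).trans_lt (sum_lt_sum_of_nonempty hne hlt)
      rw [hequiv.1 hw, sum_const, nsmul_eq_mul, card_erase_zero] at h1
      have h2 : (-(Q * D.fixed.card) * (p - 1) : ℂ)
          = ((-((p - 1) * (Q * D.fixed.card)) : ℝ) : ℂ) := by push_cast; ring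
      rw [h2, Complex.norm_real, Real.norm_eq_abs, abs_neg] at h1
      exact absurd (le_abs_self _) (not_le.2 h1)
    refine ⟨hdeg, ?_⟩
    obtain ⟨x₀, hx₀⟩ : ∃ x₀, D.lam a b x₀ = c := by
      by_contra! hcon
      have h1 := hequiv.1 hw
      rw [sum_eq_zero] at h1
      · exact (mul_ne_zero (neg_ne_zero.2 (mul_ne_zero hQC hPC)) hpC1) h1.symm
      · intro u hu
        have hu := (mem_erase.1 hu).1
        rw [wordSum_eq]
        refine mul_eq_zero_of_right _ (D.expSum_eq_zero p (by simp [ZMod.map_smul, ha]) _ _ ?_)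
        intro x hx
        simp only [Prod.smul_mk, lam_smul] at hx
        exact hcon x (smul_right_injective F hu hx)
    refine ⟨x₀, hx₀.symm, ?_⟩
    by_contra hh
    have h1 := hequiv.1 hw
    rw [← hx₀, D.sum_wordSum_of_degenerate p hnorm hdeg, if_neg hh] at h1
    have h2 := mul_left_cancel₀ (neg_ne_zero.2 (mul_ne_zero hQC hPC)) h1
    exact hpC (by linear_combination -h2)
  · rintro ⟨hdeg, x₀, rfl, rfl⟩
    rw [hequiv, D.sum_wordSum_of_degenerate p hnorm hdeg, if_pos rfl]

include hq hQ in
theorem le_card_supp_of_ne_zero {t : F × F × F × ZMod p} (ha : D.conj t.1 = t.1) (ht : t ≠ 0) :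
    ((p : ℝ) - 1) * (Q ^ 2 - Q * D.fixed.card) ≤ p * (D.supp p t).card := by
  by_cases hab : t.1 ≠ 0 ∨ t.2.1 ≠ 0
  · exact D.le_card_supp p hq ha hab
  obtain ⟨a, b, c, h⟩ := t
  push Not at hab
  obtain ⟨rfl, rfl⟩ := hab
  have hp : (1 : ℝ) < p := by exact_mod_cast (Fact.out : p.Prime).one_lt
  have hpos : 0 ≤ ((p : ℝ) - 1) * (Q * D.fixed.card) := mul_nonneg (by linarith) (by positivity)
  by_cases hc : c = 0
  · subst hc
    have hh : h ≠ 0 := by rintro rfl; exact ht rfl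
    rw [D.card_supp_of_const p hh, hq]
    push_cast
    nlinarith [sq_nonneg (Q : ℝ)]
  · have h1 := D.card_supp_of_linear p hc h
    rw [hq] at h1
    have h2 : (p : ℝ) * (D.supp p (0, 0, c, h)).card = (p - 1) * Q ^ 2 := by
      exact_mod_cast h1
    rw [h2]
    linarith

/-- The parameters of the words whose form is degenerate and which are, up to a translation,
equal to that form. -/
noncomputable def extremal : Finset (F × F × F × ZMod p) := by
  classical exact univ.filter fun t => (t.1, t.2.1) ∈ D.degenerate ∧
    ∃ x₀, t.2.2.1 = D.lam t.1 t.2.1 x₀ ∧ t.2.2.2 = D.form p t.1 t.2.1 x₀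

theorem mem_extremal {t : F × F × F × ZMod p} : t ∈ D.extremal p ↔ (t.1, t.2.1) ∈ D.degenerate ∧
    ∃ x₀, t.2.2.1 = D.lam t.1 t.2.1 x₀ ∧ t.2.2.2 = D.form p t.1 t.2.1 x₀ := by
  simp [extremal]

theorem ne_zero_of_mem_extremal {t : F × F × F × ZMod p} (ht : t ∈ D.extremal p) : t ≠ 0 := by
  rintro rfl
  simpa using (D.mem_degenerate.1 ((D.mem_extremal p).1 ht).1).2.2

theorem card_extremal :
    (D.extremal p).card * D.fixed.card ^ 2 = D.degenerate.card * Fintype.card F := by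
  classical
  set f : (F × F) × F → F × F × F × ZMod p := fun t =>
    (t.1.1, t.1.2, D.lam t.1.1 t.1.2 t.2, D.form p t.1.1 t.1.2 t.2) with hf
  have himg : (D.degenerate ×ˢ (univ : Finset F)).image f = D.extremal p := by
    ext ⟨a, b, c, h⟩
    rw [mem_extremal]
    simp only [mem_image, mem_product, mem_univ, and_true, hf, Prod.mk.injEq, Prod.exists]
    constructor
    · rintro ⟨a, b, x, hab, rfl, rfl, rfl, rfl⟩
      exact ⟨hab, x, rfl, rfl⟩
    · rintro ⟨hab, x, rfl, rfl⟩
      exact ⟨a, b, x, hab, rfl, rfl, rfl, rfl⟩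
  have h1 := card_eq_sum_card_image f (D.degenerate ×ˢ (univ : Finset F))
  rw [card_product, card_univ, himg] at h1
  rw [h1, ← smul_eq_mul]
  refine (sum_eq_card_nsmul ?_).symm
  rintro t ht
  rw [← himg] at ht
  obtain ⟨⟨⟨a, b⟩, x₀⟩, hab, rfl⟩ := mem_image.1 ht
  have hab := (mem_product.1 hab).1
  simp only at hab
  obtain ⟨ha, hk, -⟩ := D.mem_degenerate.1 hab
  simp only at ha hk
  rw [← hk]
  refine card_nbij' (fun t => t.2 - x₀) (fun k => ((a, b), k + x₀)) ?_ ?_ ?_ ?_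
  · rintro ⟨⟨a', b'⟩, x⟩ hx
    simp only [coe_filter, Set.mem_ofPred_eq, hf, Prod.mk.injEq] at hx
    obtain ⟨-, rfl, rfl, hx, -⟩ := hx
    simp [mem_ker, lam_sub, hx]
  · intro k hk
    have hk := D.mem_ker.1 hk
    simp only [coe_filter, Set.mem_ofPred_eq, hf, Prod.mk.injEq, mem_product, mem_univ, and_true]
    refine ⟨hab, trivial, trivial, by rw [lam_add, hk, zero_add], ?_⟩
    rw [D.form_add p ha, D.form_of_mem_ker p ha hk, ← D.absTrace_lam_mul p ha, hk, zero_mul,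
      absTrace, map_zero, zero_add, add_zero]
  · rintro ⟨⟨a', b'⟩, x⟩ hx
    simp only [coe_filter, Set.mem_ofPred_eq, hf, Prod.mk.injEq] at hx
    obtain ⟨-, rfl, rfl, -⟩ := hx
    simp
  · intro k _
    exact add_sub_cancel_right k x₀

theorem mem_supp {t : F × F × F × ZMod p} {x : F} : x ∈ D.supp p t ↔ D.word p t x ≠ 0 := by
  simp [supp]

theorem word_sub (t t' : F × F × F × ZMod p) (x : F) :
    D.word p (t - t') x = D.word p t x - D.word p t' x := by
  have h1 : D.form p (t.1 - t'.1) (t.2.1 - t'.2.1) x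
      = D.form p t.1 t.2.1 x - D.form p t'.1 t'.2.1 x := by
    simp only [form, absTrace, ← map_sub]
    congr 1
    ring
  have h2 : absTrace p ((t.2.2.1 - t'.2.2.1) * x)
      = absTrace p (t.2.2.1 * x) - absTrace p (t'.2.2.1 * x) := by
    rw [sub_mul, absTrace, map_sub]
  simp only [word, Prod.fst_sub, Prod.snd_sub, h1, h2]
  ring

theorem supp_smul {u : ZMod p} (hu : u ≠ 0) (t : F × F × F × ZMod p) :
    D.supp p (u • t) = D.supp p t := by
  ext x
  simp [mem_supp, word_smul, hu]

theorem sum_card_supp_sub_smul {t t' : F × F × F × ZMod p} (h : D.supp p t = D.supp p t') :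
    (∑ u ∈ univ.erase (0 : ZMod p), (D.supp p (t - u • t')).card : ℝ)
      = (p - 2) * (D.supp p t).card := by
  have h1 : ∀ u : ZMod p, ((D.supp p (t - u • t')).card : ℝ) = (D.supp p t).card
      - ((D.supp p t).filter fun x => D.word p t x / D.word p t' x = u).card := by
    intro u
    rw [eq_sub_iff_add_eq, add_comm]
    norm_cast
    rw [← card_filter_add_card_filter_not (s := D.supp p t)
      (fun x => D.word p t x / D.word p t' x = u)]
    congr 2
    ext x
    rw [mem_filter, mem_supp, word_sub, word_smul]
    by_cases hx : x ∈ D.supp p t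
    · have hx' : D.word p t' x ≠ 0 := (D.mem_supp p).1 (h ▸ hx)
      rw [div_eq_iff hx', sub_ne_zero]
      simp [hx]
    · have hx' := hx
      rw [h] at hx'
      simp only [mem_supp, ne_eq, not_not] at hx hx'
      simp [hx, hx', mem_supp]
  have h2 : (D.supp p t).card = ∑ u ∈ univ.erase (0 : ZMod p),
      ((D.supp p t).filter fun x => D.word p t x / D.word p t' x = u).card := by
    refine card_eq_sum_card_fiberwise fun x hx => ?_
    have hx' : D.word p t' x ≠ 0 := (D.mem_supp p).1 (h ▸ hx)
    have hx := (D.mem_supp p).1 hx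
    simp [hx, hx']
  rw [sum_congr rfl fun u _ => h1 u, sum_sub_distrib, sum_const, nsmul_eq_mul, card_erase_zero]
  rw [← Nat.cast_sum, ← h2]
  ring

include hq hnorm hQ in
theorem mem_extremal_iff {t : F × F × F × ZMod p} : t ∈ D.extremal p ↔ D.conj t.1 = t.1 ∧
    (p : ℝ) * (D.supp p t).card = (p - 1) * (Q ^ 2 + Q * D.fixed.card) := by
  rw [mem_extremal]
  constructor
  · intro ht
    have ha := (D.mem_degenerate.1 ht.1).1
    exact ⟨ha, (D.card_supp_eq_iff p hq hQ hnorm ha).2 ht⟩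
  · rintro ⟨ha, ht⟩
    exact (D.card_supp_eq_iff p hq hQ hnorm ha).1 ht

include hq hnorm hQ in
theorem exists_eq_smul_of_supp_eq {t t' : F × F × F × ZMod p} (ht : t ∈ D.extremal p)
    (ht' : t' ∈ D.extremal p) (h : D.supp p t = D.supp p t') :
    ∃ u : ZMod p, u ≠ 0 ∧ u • t' = t := by
  by_contra! hcon
  obtain ⟨ha, hw⟩ := (D.mem_extremal_iff p hq hQ hnorm).1 ht
  have ha' := ((D.mem_extremal_iff p hq hQ hnorm).1 ht').1
  have h1 := D.sum_card_supp_sub_smul p h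
  have h2 : ((p : ℝ) - 1) * ((p - 1) * (Q ^ 2 - Q * D.fixed.card))
      ≤ p * ∑ u ∈ univ.erase (0 : ZMod p), ((D.supp p (t - u • t')).card : ℝ) := by
    rw [← card_erase_zero p, ← nsmul_eq_mul, mul_sum, card_erase_zero]
    refine card_nsmul_le_sum _ _ _ fun u hu => ?_
    refine D.le_card_supp_of_ne_zero p hq hQ ?_ (sub_ne_zero.2 (hcon u (mem_erase.1 hu).1).symm)
    rw [Prod.fst_sub, Prod.smul_fst, map_sub, ZMod.map_smul, ha, ha']
  rw [h1, mul_left_comm (p : ℝ), hw] at h2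
  have hp : (2 : ℝ) ≤ p := by exact_mod_cast (Fact.out : p.Prime).two_le
  have hP : (1 : ℝ) < D.fixed.card := by exact_mod_cast D.one_lt_card_fixed
  have hQR : 2 * (p : ℝ) * D.fixed.card ≤ Q := by exact_mod_cast hQ
  have hQ0 : (0 : ℝ) < Q := lt_of_lt_of_le (by positivity) hQR
  have h3 : ((p : ℝ) - 1) * Q * ((Q : ℝ) - (2 * p - 3) * D.fixed.card) ≤ 0 := by
    linear_combination h2
  have h4 : 0 < ((p : ℝ) - 1) * Q * ((Q : ℝ) - (2 * p - 3) * D.fixed.card) := by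
    have : 0 < (p : ℝ) - 1 := by linarith
    have : 0 < (Q : ℝ) - (2 * p - 3) * D.fixed.card := by linarith
    positivity
  linarith

/-- The supports of the words with parameters in `TwistedConj.extremal`. -/
noncomputable def supports : Finset (Finset F) := (D.extremal p).image (D.supp p)

include hq hnorm hQ in
theorem card_supports : (D.supports p).card * (p - 1) = (D.extremal p).card := by
  classical
  rw [card_eq_sum_card_image (D.supp p) (D.extremal p), ← smul_eq_mul]
  refine (sum_eq_card_nsmul ?_).symm
  intro S hS
  obtain ⟨t, ht, rfl⟩ := mem_image.1 hS
  have ht0 := D.ne_zero_of_mem_extremal p ht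
  have h1 : (D.extremal p).filter (fun t' => D.supp p t' = D.supp p t)
      = (univ.erase (0 : ZMod p)).image fun u => u • t := by
    ext t'
    simp only [mem_filter, mem_image, mem_erase, mem_univ, and_true]
    constructor
    · rintro ⟨ht', h⟩
      exact D.exists_eq_smul_of_supp_eq p hq hQ hnorm ht' ht h
    · rintro ⟨u, hu, rfl⟩
      refine ⟨?_, D.supp_smul p hu t⟩
      rw [mem_extremal_iff p D hq hQ hnorm, D.supp_smul p hu, Prod.smul_fst, ZMod.map_smul] at *
      exact ⟨by rw [ht.1], ht.2⟩
  rw [h1, card_image_of_injective, card_erase_of_mem (mem_univ _), card_univ, ZMod.card]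
  intro u v huv
  by_contra hne
  have : (u - v) • t = 0 := by rw [sub_smul, sub_eq_zero]; exact huv
  exact (smul_ne_zero (sub_ne_zero.2 hne) ht0) this

theorem exists_word_comp_affine {t : F × F × F × ZMod p} (ha : D.conj t.1 = t.1) (u v : F) :
    ∃ t' : F × F × F × ZMod p, D.conj t'.1 = t'.1 ∧ ∀ x, D.word p t' x = D.word p t (u * x + v) := by
  obtain ⟨a, b, c, h⟩ := t
  simp only at ha
  refine ⟨(a * (u * D.conj u), b * (u * D.twist u), u * (D.lam a b v + c),
    D.form p a b v + absTrace p (c * v) + h), ?_, fun x => ?_⟩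
  · simp only [map_mul, D.conj_conj, ha]
    ring
  · have h1 : D.form p (a * (u * D.conj u)) (b * (u * D.twist u)) x = D.form p a b (u * x) := by
      simp only [form, map_mul]
      congr 1
      ring
    simp only [word]
    rw [D.form_add p ha, h1, mul_add c, show u * (D.lam a b v + c) * x
      = u * x * D.lam a b v + c * (u * x) by ring]
    simp only [absTrace, map_add]
    ring

theorem card_filter_affine {u : F} (hu : u ≠ 0) (v : F) (S : Finset F) :
    (univ.filter fun x => u * x + v ∈ S).card = S.card := by
  refine card_nbij' (fun x => u * x + v) (fun y => u⁻¹ * (y - v)) ?_ ?_ ?_ ?_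
  · intro x hx
    simpa using hx
  · intro y hy
    simpa [hu] using hy
  · intro x _
    simp [hu]
  · intro y _
    simp [hu]

include hq hnorm hQ in
theorem filter_affine_mem_supports {u : F} (hu : u ≠ 0) (v : F) {S : Finset F}
    (hS : S ∈ D.supports p) : (univ.filter fun x => u * x + v ∈ S) ∈ D.supports p := by
  obtain ⟨t, ht, rfl⟩ := mem_image.1 hS
  obtain ⟨ha, hw⟩ := (D.mem_extremal_iff p hq hQ hnorm).1 ht
  obtain ⟨t', ha', ht'⟩ := D.exists_word_comp_affine p ha u v
  have h1 : (univ.filter fun x => u * x + v ∈ D.supp p t) = D.supp p t' := by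
    ext x
    simp [mem_supp, ht']
  rw [h1]
  refine mem_image_of_mem _ ((D.mem_extremal_iff p hq hQ hnorm).2 ⟨ha', ?_⟩)
  rw [← h1, card_filter_affine hu, hw]

include hq hnorm hQ in
theorem card_supports_through_le {x y x' y' : F} (hxy : x ≠ y) (hxy' : x' ≠ y') :
    ((D.supports p).filter fun S => x ∈ S ∧ y ∈ S).card
      ≤ ((D.supports p).filter fun S => x' ∈ S ∧ y' ∈ S).card := by
  have h0 : x' - y' ≠ 0 := sub_ne_zero.2 hxy'
  set u := (x - y) / (x' - y') with hu
  have hu0 : u ≠ 0 := div_ne_zero (sub_ne_zero.2 hxy) h0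
  set v := x - u * x' with hv
  have hx : u * x' + v = x := by rw [hv]; ring
  have hy : u * y' + v = y := by
    have : u * (x' - y') = x - y := div_mul_cancel₀ _ h0
    rw [hv]
    linear_combination -this
  refine card_le_card_of_injOn (fun S => univ.filter fun z => u * z + v ∈ S) ?_ ?_
  · intro S hS
    obtain ⟨hS, hxS, hyS⟩ := mem_filter.1 hS
    refine mem_filter.2 ⟨D.filter_affine_mem_supports p hq hQ hnorm hu0 v hS, ?_⟩
    simp [hx, hy, hxS, hyS]
  · intro S _ T _ h
    ext z
    have h1 := Finset.ext_iff.1 h (u⁻¹ * (z - v))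
    simpa [hu0] using h1

include hq hnorm hQ in
theorem card_supports_through {i : ℕ}
    (hi : (p : ℝ) * i = (p - 1) * (Q ^ 2 + Q * D.fixed.card)) {x y : F} (hxy : x ≠ y) :
    Fintype.card F * (Fintype.card F - 1)
        * ((D.supports p).filter fun S => x ∈ S ∧ y ∈ S).card
      = (D.supports p).card * (i * (i - 1)) := by
  have hp : (p : ℝ) ≠ 0 := by exact_mod_cast (Fact.out : p.Prime).ne_zero
  have hoff : ∀ S : Finset F, S.offDiag.card = S.card * (S.card - 1) := by
    intro S
    rw [offDiag_card, Nat.mul_sub, mul_one]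
  rw [← card_univ, ← hoff]
  refine card_mul_eq_card_mul (fun (z : F × F) S => z.1 ∈ S ∧ z.2 ∈ S) ?_ ?_
  · rintro ⟨x', y'⟩ h
    have hxy' := (mem_offDiag.1 h).2.2
    exact le_antisymm (D.card_supports_through_le p hq hQ hnorm hxy' hxy)
      (D.card_supports_through_le p hq hQ hnorm hxy hxy')
  · intro S hS
    have h1 : bipartiteBelow (fun (z : F × F) S => z.1 ∈ S ∧ z.2 ∈ S) (univ : Finset F).offDiag S
        = S.offDiag := by
      ext z
      simp only [mem_bipartiteBelow, mem_offDiag, mem_univ, true_and]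
      tauto
    obtain ⟨t, ht, rfl⟩ := mem_image.1 hS
    have hw := ((D.mem_extremal_iff p hq hQ hnorm).1 ht).2
    rw [← hi] at hw
    have h2 : (D.supp p t).card = i := by exact_mod_cast mul_left_cancel₀ hp hw
    rw [h1, hoff, h2]

include hq hnorm hQ in
theorem card_supports_through_eq {R i : ℕ} (hR : Q = R * D.fixed.card)
    (hfix : (univ.filter fun z => D.conj z = z).card = Q)
    (hi : p * i = (p - 1) * (Q ^ 2 + Q * D.fixed.card)) {x y : F} (hxy : x ≠ y) :
    (p : ℚ) * (D.fixed.card ^ 2 - 1) * ((D.supports p).filter fun S => x ∈ S ∧ y ∈ S).card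
      = R * (i - 1) * (R ^ 2 - 1) := by
  have hp : 1 < p := (Fact.out : p.Prime).one_lt
  have hP := D.one_lt_card_fixed
  have hQ0 : 0 < Q := lt_of_lt_of_le (by positivity) hQ
  have hi0 : 1 ≤ i := Nat.one_le_iff_ne_zero.2 fun h => by
    have : 0 < (p - 1) * (Q ^ 2 + Q * D.fixed.card) := Nat.mul_pos (by omega) (by positivity)
    rw [← hi, h, mul_zero] at this
    exact this.false
  have h1 := D.card_degenerateAtOne
  rw [hfix, hR] at h1
  have hA := Nat.eq_of_mul_eq_mul_right (by omega) h1
  have h2 := D.card_degenerate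
  have h3 := D.card_extremal p
  have h4 := D.card_supports p hq hQ hnorm
  have h5 := D.card_supports_through p hq hQ hnorm (i := i)
    (by rw [← Nat.cast_one, ← Nat.cast_sub hp.le]; exact_mod_cast hi) hxy
  have hF1 : 1 < Fintype.card F := Fintype.one_lt_card
  have hP2 : 1 ≤ D.fixed.card ^ 2 := Nat.one_le_pow _ _ (by omega)
  set N := ((D.supports p).filter fun S => x ∈ S ∧ y ∈ S).card
  set P := D.fixed.card
  set q := Fintype.card F
  qify [hp.le, hP2, hF1.le, hi0] at hi h2 h3 h4 h5 hR hp hF1 hP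
  have hp0 : (p : ℚ) ≠ 0 := by linarith
  have hp1 : (p : ℚ) - 1 ≠ 0 := by linarith
  have hq0 : (q : ℚ) ≠ 0 := by linarith
  have hq1 : (q : ℚ) - 1 ≠ 0 := by linarith
  have hP0 : (P : ℚ) ≠ 0 := by linarith
  have hi' : (p : ℚ) * i = (p - 1) * P ^ 2 * R * (R + 1) := by
    rw [hi, hR]
    ring
  have hn : (D.degenerateAtOne.card : ℚ) = R - 1 := by rw [← hA]; push_cast; ring
  rw [hn] at h2
  refine mul_left_cancel₀ (a := (q : ℚ) * (q - 1) * (p - 1) * P ^ 2)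
    (mul_ne_zero (mul_ne_zero (mul_ne_zero hq0 hq1) hp1) (pow_ne_zero 2 hP0)) ?_
  linear_combination (p - 1 : ℚ) * P ^ 2 * p * (P ^ 2 - 1) * h5
    + (P : ℚ) ^ 2 * (P ^ 2 - 1) * p * i * (i - 1) * h4 + (P ^ 2 - 1 : ℚ) * p * i * (i - 1) * h3
    + (q : ℚ) * p * i * (i - 1) * h2 + (q - 1 : ℚ) * (R - 1) * q * (i - 1) * hi'

end Extremal

end TwistedConj

section Frobenius

variable (p : ℕ) [Fact p.Prime] {F : Type} [Field F] [Fintype F] [DecidableEq F]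

theorem card_filter_pow_eq {n m : ℕ} (hnm : n * m = Fintype.card F - 1) {z : F} (hz : z ≠ 0)
    (hzm : z ^ m = 1) : (univ.filter fun y => y ^ n = z).card = n := by
  obtain ⟨g, hg⟩ := IsCyclic.exists_ofOrder_eq_natCard (α := Fˣ)
  rw [Nat.card_eq_fintype_card, Fintype.card_units, ← hnm] at hg
  have hpos : 0 < n * m := hg ▸ orderOf_pos g
  have hn : 0 < n := Nat.pos_of_mul_pos_right hpos
  have hm : 0 < m := Nat.pos_of_mul_pos_left hpos
  have hprim : IsPrimitiveRoot (g : F) (n * m) :=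
    hg ▸ (IsPrimitiveRoot.orderOf g).map_of_injective (f := Units.coeHom F) Units.val_injective
  have hprimn : IsPrimitiveRoot ((g : F) ^ m) n := hprim.pow hpos (mul_comm n m)
  have hroot : ∃ y : F, y ^ n = z := by
    have hz1 : z ^ (n * m) = 1 := by rw [mul_comm, pow_mul, hzm, one_pow]
    have : NeZero (n * m) := ⟨hpos.ne'⟩
    obtain ⟨k, -, hk⟩ := hprim.eq_pow_of_pow_eq_one hz1
    rw [← hk, ← pow_mul] at hzm
    have hdvd := (hprim.pow_eq_one_iff_dvd _).1 hzm
    obtain ⟨j, rfl⟩ := Nat.dvd_of_mul_dvd_mul_right hm hdvd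
    exact ⟨(g : F) ^ j, by rw [← hk, ← pow_mul, mul_comm]⟩
  have h1 : (univ.filter fun y => y ^ n = z) = (Polynomial.nthRoots n z).toFinset := by
    ext y
    simp [Polynomial.mem_nthRoots hn]
  rw [h1, Multiset.toFinset_card_of_nodup (hprimn.nthRoots_nodup hz), hprimn.card_nthRoots,
    if_pos hroot]

theorem card_filter_pow_eq_self {r k : ℕ} (hF : Fintype.card F = p ^ r) (hk : k ∣ r) :
    (univ.filter fun y : F => y ^ p ^ k = y).card = p ^ k := by
  have hpos : 0 < p ^ k := pow_pos (Fact.out : p.Prime).pos k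
  obtain ⟨m, hm⟩ : p ^ k - 1 ∣ Fintype.card F - 1 := by
    obtain ⟨j, rfl⟩ := hk
    rw [hF, pow_mul]
    simpa using Nat.sub_dvd_pow_sub_pow (p ^ k) 1 j
  have h1 := card_filter_pow_eq hm.symm one_ne_zero (one_pow m)
  have h2 : (univ.filter fun y : F => y ^ p ^ k = y)
      = insert 0 (univ.filter fun y => y ^ (p ^ k - 1) = 1) := by
    ext y
    simp only [mem_filter, mem_univ, true_and, mem_insert]
    by_cases hy : y = 0
    · simp [hy, (Fact.out : p.Prime).ne_zero]
    · rw [← mul_pow_sub_one hpos.ne' y]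
      simp [hy]
  have hk0 : p ^ k - 1 ≠ 0 := by
    rintro h
    rw [h, zero_mul] at hm
    have := Fintype.one_lt_card (α := F)
    omega
  rw [h2, card_insert_of_notMem, h1]
  · omega
  · simp [hk0]

theorem pow_pow_gcd_eq_self {R : Type*} [Monoid R] {x : R} {m n : ℕ} (hm : x ^ p ^ m = x)
    (hn : x ^ p ^ n = x) : x ^ p ^ m.gcd n = x := by
  have h : ∀ k, Function.IsPeriodicPt (fun x : R => x ^ p) k x ↔ x ^ p ^ k = x := fun k => by
    rw [Function.IsPeriodicPt, Function.IsFixedPt, pow_iterate]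
  rw [← h] at *
  exact hm.gcd hn

theorem pow_pow_eq_self_of_dvd {R : Type*} [Monoid R] {x : R} {m n : ℕ} (hm : x ^ p ^ m = x)
    (hn : m ∣ n) : x ^ p ^ n = x := by
  have h : ∀ k, Function.IsPeriodicPt (fun x : R => x ^ p) k x ↔ x ^ p ^ k = x := fun k => by
    rw [Function.IsPeriodicPt, Function.IsFixedPt, pow_iterate]
  rw [← h] at *
  exact hm.trans_dvd hn

variable [CharP F p] {s l : ℕ}

/-- The involution `x ↦ x ^ p ^ s` of the field with `p ^ (2 * s)` elements, together with the
automorphism `x ↦ x ^ p ^ l`. -/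
noncomputable def frobeniusTwistedConj (hp : Odd p) (hF : Fintype.card F = p ^ (2 * s))
    (hsl : (s + l).gcd (2 * s) ∣ s) : TwistedConj F where
  conj := iterateFrobeniusEquiv F p s
  twist := iterateFrobeniusEquiv F p l
  conj_conj x := by
    rw [← iterateFrobeniusEquiv_add_apply, ← two_mul, iterateFrobeniusEquiv_def, ← hF,
      FiniteField.pow_card]
  conj_twist x := by
    rw [← iterateFrobeniusEquiv_add_apply, ← iterateFrobeniusEquiv_add_apply, add_comm]
  conj_of_fixed x hx := by
    rw [← iterateFrobeniusEquiv_add_apply, iterateFrobeniusEquiv_def] at hx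
    rw [iterateFrobeniusEquiv_def]
    exact pow_pow_eq_self_of_dvd p (pow_pow_gcd_eq_self p hx (hF ▸ FiniteField.pow_card x)) hsl
  two_ne := by
    apply Ring.two_ne_zero
    rw [ringChar.eq F p]
    rintro rfl
    exact absurd hp (by decide)

variable (hp : Odd p) (hF : Fintype.card F = p ^ (2 * s)) (hsl : (s + l).gcd (2 * s) ∣ s)

theorem frobeniusTwistedConj_conj (x : F) :
    (frobeniusTwistedConj p hp hF hsl).conj x = x ^ p ^ s := rfl

theorem frobeniusTwistedConj_twist (x : F) :
    (frobeniusTwistedConj p hp hF hsl).twist x = x ^ p ^ l := rfl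

theorem card_fixed_frobeniusTwistedConj :
    (frobeniusTwistedConj p hp hF hsl).fixed.card = p ^ (s + l).gcd (2 * s) := by
  rw [← card_filter_pow_eq_self p hF (Nat.gcd_dvd_right (s + l) (2 * s))]
  congr 1
  ext x
  rw [TwistedConj.mem_fixed, frobeniusTwistedConj_conj, frobeniusTwistedConj_twist, ← pow_mul,
    ← pow_add, mem_filter, add_comm l s]
  refine ⟨fun hx => ⟨mem_univ _, pow_pow_gcd_eq_self p hx (hF ▸ FiniteField.pow_card x)⟩,
    fun hx => pow_pow_eq_self_of_dvd p hx.2 (Nat.gcd_dvd_left _ _)⟩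

theorem card_norm_fibre_frobeniusTwistedConj {z : F} (hz : z ≠ 0)
    (hzs : (frobeniusTwistedConj p hp hF hsl).conj z = z) :
    (univ.filter fun y => y * (frobeniusTwistedConj p hp hF hsl).conj y = z).card = p ^ s + 1 := by
  have hpos : 0 < p ^ s := pow_pos (Fact.out : p.Prime).pos s
  have h1 : (p ^ s + 1) * (p ^ s - 1) = Fintype.card F - 1 := by
    rw [← Nat.sq_sub_sq, hF, mul_comm, pow_mul, one_pow]
  rw [frobeniusTwistedConj_conj] at hzs
  rw [← card_filter_pow_eq h1 hz]
  · congr 1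
    ext y
    rw [mem_filter, mem_filter, frobeniusTwistedConj_conj, pow_succ']
  · rw [← mul_pow_sub_one hpos.ne' z] at hzs
    exact mul_left_cancel₀ hz (hzs.trans (mul_one z).symm)

variable [Algebra (ZMod p) F]

theorem algebraMap_absTrace (hF : Fintype.card F = p ^ (2 * s)) (x : F) :
    algebraMap (ZMod p) F (absTrace p x) = trp p (2 * s) x := by
  have h1 : Module.finrank (ZMod p) F = 2 * s := by
    have := Module.card_eq_pow_finrank (K := ZMod p) (V := F)
    rw [ZMod.card, hF] at this
    exact (Nat.pow_right_injective (Fact.out : p.Prime).two_le this).symm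
  rw [absTrace, FiniteField.algebraMap_trace_eq_sum_pow, h1, Nat.card_zmod, trp]

theorem trp_add {r : ℕ} (x y : F) : trp p r (x + y) = trp p r x + trp p r y := by
  simp only [trp, add_pow_char_pow, sum_add_distrib]

theorem trp_two_mul {x : F} (hx : x ^ p ^ s = x) : trp p (2 * s) x = 2 * trp p s x := by
  rw [trp, two_mul s, sum_range_add, two_mul]
  simp only [pow_add, pow_mul, hx, trp]

theorem cword_eq_algebraMap_word {a : F} (ha : a ^ p ^ s = a) (b c : F) (h : ZMod p) (x : F) :
    cword p s l a b c h x
      = algebraMap (ZMod p) F ((frobeniusTwistedConj p hp hF hsl).word p (a, b, c, h) x) := by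
  have h2 := (frobeniusTwistedConj p hp hF hsl).two_ne
  have h3 : (ZMod.cast h : F) = algebraMap (ZMod p) F h := by
    change ZMod.castHom (dvd_refl p) F h = _
    congr 1
    exact Subsingleton.elim _ _
  have h4 : (a / 2 * (x * x ^ p ^ s)) ^ p ^ s = a / 2 * (x * x ^ p ^ s) := by
    have hc := (frobeniusTwistedConj p hp hF hsl).conj_conj x
    have h5 : (2 : F) ^ p ^ s = 2 := by
      rw [← frobeniusTwistedConj_conj p hp hF hsl, map_ofNat]
    simp only [frobeniusTwistedConj_conj] at hc
    rw [mul_pow, div_pow, ha, h5, mul_pow, hc, mul_comm x]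
  have h6 : a * x ^ (p ^ s + 1) = a / 2 * (x * x ^ p ^ s) + a / 2 * (x * x ^ p ^ s) := by
    rw [pow_succ']
    field_simp
    ring
  rw [cword, TwistedConj.word, TwistedConj.form, map_add, map_add, algebraMap_absTrace p hF,
    algebraMap_absTrace p hF, h3, trp_add, h6, trp_add, ← two_mul, ← trp_two_mul p h4]
  simp only [frobeniusTwistedConj_conj, frobeniusTwistedConj_twist, trp_add, pow_succ']
  ring

theorem suppw_eq_supp {a : F} (ha : a ^ p ^ s = a) (b c : F) (h : ZMod p) :
    suppw p s l a b c h = (frobeniusTwistedConj p hp hF hsl).supp p (a, b, c, h) := by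
  ext x
  rw [suppw, TwistedConj.mem_supp, mem_filter, cword_eq_algebraMap_word p hp hF hsl ha]
  simp

end Frobenius

theorem add_two_le_of_gcd_eq {s l d : ℕ} (hls : l ≠ s) (hl1 : 1 ≤ l) (hl2 : l ≤ 2 * s - 1)
    (hd : Nat.gcd s l = d) (hdeven : Even d) : d + 2 ≤ s := by
  have hd0 : 0 < d := hd ▸ Nat.gcd_pos_of_pos_right s hl1
  obtain ⟨j, hj⟩ : d ∣ l := hd ▸ Nat.gcd_dvd_right s l
  obtain ⟨k, hk⟩ : d ∣ s := hd ▸ Nat.gcd_dvd_left s l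
  have hd2 : 2 ≤ d := Nat.le_of_dvd hd0 hdeven.two_dvd
  have hk2 : 2 ≤ k := by
    by_contra! hk2
    interval_cases k
    · omega
    · have hj2 : d * j < d * 2 := by omega
      have := Nat.lt_of_mul_lt_mul_left hj2
      interval_cases j <;> omega
  calc d + 2 ≤ d * 2 := by omega
    _ ≤ d * k := Nat.mul_le_mul_left d hk2
    _ = s := hk.symm

theorem card_suppw_through_eq (p s l : ℕ) [Fact p.Prime] (F : Type) [Field F] [Fintype F]
    [DecidableEq F] [CharP F p] (hodd : Odd p) (hl1 : 1 ≤ l) (hls : l ≠ s)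
    (hl2 : l ≤ 2 * s - 1) (hF : Fintype.card F = p ^ (2 * s)) (d : ℕ)
    (hd : Nat.gcd s l = d) (hd' : Nat.gcd (s + l) (2 * l) = d) (hdeven : Even d) {x y : F}
    (hxy : x ≠ y) :
    (p : ℚ) * (((p : ℚ) ^ d) ^ 2 - 1) *
      (((((univ : Finset (F × F × F × ZMod p)).filter fun t =>
        t.1 ^ p ^ s = t.1 ∧ (suppw p s l t.1 t.2.1 t.2.2.1 t.2.2.2).card
            = p ^ (s + d - 1) * (p - 1) * (p ^ (s - d) + 1)).image
        fun t => suppw p s l t.1 t.2.1 t.2.2.1 t.2.2.2).filter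
        fun S => x ∈ S ∧ y ∈ S).card : ℚ)
      = (p : ℚ) ^ (s - d) * ((p : ℚ) ^ (s + d - 1) * ((p : ℚ) - 1) * ((p : ℚ) ^ (s - d) + 1) - 1)
        * (((p : ℚ) ^ (s - d)) ^ 2 - 1) := by
  let _ := ZMod.algebra F p
  have hpp : p.Prime := Fact.out
  have hgcd : (s + l).gcd (2 * s) = d := by
    rw [← hd']
    refine Nat.dvd_antisymm (Nat.dvd_gcd (Nat.gcd_dvd_left _ _) ?_)
      (Nat.dvd_gcd (Nat.gcd_dvd_left _ _) ?_)
    · refine (Nat.dvd_add_right (Nat.gcd_dvd_right (s + l) (2 * s))).1 ?_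
      rw [← mul_add]
      exact (Nat.gcd_dvd_left _ _).mul_left 2
    · refine (Nat.dvd_add_left (Nat.gcd_dvd_right (s + l) (2 * l))).1 ?_
      rw [← mul_add]
      exact (Nat.gcd_dvd_left _ _).mul_left 2
  have hds : d ∣ s := hd ▸ Nat.gcd_dvd_left s l
  have hsl : (s + l).gcd (2 * s) ∣ s := hgcd ▸ hds
  have hds2 := add_two_le_of_gcd_eq hls hl1 hl2 hd hdeven
  set D := frobeniusTwistedConj p hodd hF hsl with hD
  have hP : D.fixed.card = p ^ d := by rw [hD, card_fixed_frobeniusTwistedConj, hgcd]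
  have hR : p ^ s = p ^ (s - d) * D.fixed.card := by
    rw [hP, ← pow_add, Nat.sub_add_cancel (by omega)]
  have hq : Fintype.card F = (p ^ s) ^ 2 := by rw [hF, ← pow_mul, mul_comm]
  have hQ : 2 * p * D.fixed.card ≤ p ^ s := by
    rw [hR]
    refine Nat.mul_le_mul_right _ ?_
    calc 2 * p ≤ p * p := Nat.mul_le_mul_right _ hpp.two_le
      _ = p ^ 2 := (sq p).symm
      _ ≤ p ^ (s - d) := Nat.pow_le_pow_right hpp.pos (by omega)
  have hnorm : ∀ z, z ≠ 0 → D.conj z = z →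
      (univ.filter fun y => y * D.conj y = z).card = p ^ s + 1 := fun z hz hzs =>
    card_norm_fibre_frobeniusTwistedConj p hodd hF hsl hz hzs
  have hfix : (univ.filter fun z => D.conj z = z).card = p ^ s := by
    simpa only [hD, frobeniusTwistedConj_conj] using
      card_filter_pow_eq_self p hF (Dvd.intro_left 2 rfl)
  set i := p ^ (s + d - 1) * (p - 1) * (p ^ (s - d) + 1) with hi
  have hpi : p * i = (p - 1) * ((p ^ s) ^ 2 + p ^ s * D.fixed.card) := by
    have h1 : p * p ^ (s + d - 1) = p ^ s * D.fixed.card := by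
      rw [hP, ← pow_add, mul_pow_sub_one (by omega)]
    rw [hi, ← mul_assoc, ← mul_assoc, h1]
    calc p ^ s * D.fixed.card * (p - 1) * (p ^ (s - d) + 1)
        = (p - 1) * (p ^ s * (p ^ (s - d) * D.fixed.card) + p ^ s * D.fixed.card) := by ring
      _ = (p - 1) * ((p ^ s) ^ 2 + p ^ s * D.fixed.card) := by rw [← hR, sq]
  have hsupp : (((univ : Finset (F × F × F × ZMod p)).filter fun t =>
        t.1 ^ p ^ s = t.1 ∧ (suppw p s l t.1 t.2.1 t.2.2.1 t.2.2.2).card = i).image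
        fun t => suppw p s l t.1 t.2.1 t.2.2.1 t.2.2.2) = D.supports p := by
    rw [TwistedConj.supports]
    have hmem : ∀ t : F × F × F × ZMod p, t.1 ^ p ^ s = t.1 ∧
        (suppw p s l t.1 t.2.1 t.2.2.1 t.2.2.2).card = i ↔ t ∈ D.extremal p := by
      intro t
      rw [D.mem_extremal_iff p hq hQ hnorm, hD, frobeniusTwistedConj_conj, ← hD]
      refine and_congr_right fun ha => ?_
      rw [suppw_eq_supp p hodd hF hsl ha, ← Nat.cast_one (R := ℝ), ← Nat.cast_sub hpp.one_le]
      norm_cast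
      rw [← hpi, mul_right_inj' hpp.ne_zero]
    have hfilter : ((univ : Finset (F × F × F × ZMod p)).filter fun t =>
        t.1 ^ p ^ s = t.1 ∧ (suppw p s l t.1 t.2.1 t.2.2.1 t.2.2.2).card = i)
        = D.extremal p := by
      ext t
      rw [mem_filter, hmem]
      simp
    rw [hfilter]
    refine image_congr fun t ht => ?_
    exact suppw_eq_supp p hodd hF hsl ((hmem t).2 ht).1 _ _ _
  rw [hsupp]
  have h := D.card_supports_through_eq p hq hQ hnorm hR hfix hpi hxy
  rw [hP, hi] at h
  push_cast [hpp.one_le] at h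
  exact h

end TwistedConjugation

theorem stmt16 (p s l : ℕ) [Fact p.Prime] (F : Type) [Field F] [Fintype F] [DecidableEq F]
    [CharP F p] (hodd : Odd p) (hs : 2 ≤ s) (hl1 : 1 ≤ l) (hls : l ≠ s)
    (hl2 : l ≤ 2 * s - 1) (hF : Fintype.card F = p ^ (2 * s)) (d : ℕ)
    (hd : Nat.gcd s l = d) (hd' : Nat.gcd (s + l) (2 * l) = d) (hdeven : Even d) :
    (∀ S ∈ (((Finset.univ : Finset (F × F × F × ZMod p)).filter fun t =>
        t.1 ^ p ^ s = t.1 ∧ (suppw p s l t.1 t.2.1 t.2.2.1 t.2.2.2).card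
            = p ^ (s + d - 1) * (p - 1) * (p ^ (s - d) + 1)).image
        fun t => suppw p s l t.1 t.2.1 t.2.2.1 t.2.2.2),
      S.card = p ^ (s + d - 1) * (p - 1) * (p ^ (s - d) + 1)) ∧
    ∀ x y : F, x ≠ y →
      (((((Finset.univ : Finset (F × F × F × ZMod p)).filter fun t =>
        t.1 ^ p ^ s = t.1 ∧ (suppw p s l t.1 t.2.1 t.2.2.1 t.2.2.2).card
            = p ^ (s + d - 1) * (p - 1) * (p ^ (s - d) + 1)).image
        fun t => suppw p s l t.1 t.2.1 t.2.2.1 t.2.2.2).filter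
        fun S => x ∈ S ∧ y ∈ S).card : ℚ)
        = (p : ℚ) ^ (s - d - 1) * ((p : ℚ) ^ (s + d - 1) * ((p : ℚ) - 1) * ((p : ℚ) ^ (s - d) + 1) - 1)
          * ((p : ℚ) ^ (2 * s - 2 * d) - 1) / ((p : ℚ) ^ (2 * d) - 1) := by
  refine ⟨fun S hS => ?_, fun x y hxy => ?_⟩
  · obtain ⟨t, ht, rfl⟩ := Finset.mem_image.1 hS
    exact (Finset.mem_filter.1 ht).2.2
  · have hp1 : (1 : ℚ) < p := by exact_mod_cast (Fact.out : p.Prime).one_lt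
    have hd0 : 0 < d := hd ▸ Nat.gcd_pos_of_pos_right s hl1
    have hds := add_two_le_of_gcd_eq hls hl1 hl2 hd hdeven
    have h := card_suppw_through_eq p s l F hodd hl1 hls hl2 hF d hd hd' hdeven hxy
    have hP : (1 : ℚ) < (p : ℚ) ^ (2 * d) := one_lt_pow₀ hp1 (by omega)
    have h1 : ((p : ℚ) ^ d) ^ 2 = (p : ℚ) ^ (2 * d) := by rw [← pow_mul, mul_comm]
    have h2 : ((p : ℚ) ^ (s - d)) ^ 2 = (p : ℚ) ^ (2 * s - 2 * d) := by
      rw [← pow_mul, mul_comm, Nat.mul_sub]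
    have h3 : (p : ℚ) * (p : ℚ) ^ (s - d - 1) = (p : ℚ) ^ (s - d) :=
      mul_pow_sub_one (by omega) _
    rw [h1, h2] at h
    rw [eq_div_iff (by linarith)]
    refine mul_left_cancel₀ (by linarith : (p : ℚ) ≠ 0) ?_
    linear_combination h
      - ((p : ℚ) ^ (s + d - 1) * ((p : ℚ) - 1) * ((p : ℚ) ^ (s - d) + 1) - 1)
        * ((p : ℚ) ^ (2 * s - 2 * d) - 1) * h3
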